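/- arXiv:2506.14118 — 2 statements merged into one kernel-verified Lean document; each statement's English description precedes it below -/
import Mathlib

section
/- Let r, s be integers with r ≥ 1 and s ≥ r + 1, and set 𝒫^{r,s} := conv{(0,0),(1,1)} + conv{(0,0),(1,2)} + ⋯ + conv{(0,0),(1,r)} + conv{(0,0),(0,1),(1,s+1)} ⊂ ℝ² (Minkowski sum). Then 𝒫^{r,s} is a toric diagram with exactly 2r + 3 extreme points, and, up to translating the summands and reordering them, the displayed decomposition is the unique lattice maximal Minkowski decomposition of 𝒫^{r,s}, i.e., the unique way of writing 𝒫^{r,s} as a Minkowski sum of at least two lattice segments and lattice triangles. -/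
open Set Pointwise

noncomputable section

/-- We work in the plane `ℝ × ℝ`. -/
abbrev V : Type := ℝ × ℝ

/-- The embedding of the lattice `ℤ × ℤ` into the plane. -/
def toR (p : ℤ × ℤ) : V := ((p.1 : ℝ), (p.2 : ℝ))

/-- The set of lattice points of the plane. -/
def latticePoints : Set V := Set.range toR

/-- A lattice polytope: the convex hull of a nonempty finite set of lattice points. -/
def IsLatticePolytope (P : Set V) : Prop :=
  ∃ S : Finset (ℤ × ℤ), S.Nonempty ∧ P = convexHull ℝ (toR '' ↑S)

/-- A toric diagram: a two-dimensional lattice polytope such that every lattice point on its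
topological boundary is an extreme point. -/
def IsToricDiagram (P : Set V) : Prop :=
  IsLatticePolytope P ∧ (interior P).Nonempty ∧
    ∀ x ∈ frontier P, x ∈ latticePoints → x ∈ P.extremePoints ℝ

/-- A lattice segment: the convex hull of two distinct lattice points. -/
def IsLatticeSegment (L : Set V) : Prop :=
  ∃ a b : ℤ × ℤ, a ≠ b ∧ L = segment ℝ (toR a) (toR b)

/-- A lattice triangle: the convex hull of three affinely independent lattice points. -/
def IsLatticeTriangle (T : Set V) : Prop :=
  ∃ a b c : ℤ × ℤ, AffineIndependent ℝ ![toR a, toR b, toR c] ∧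
    T = convexHull ℝ {toR a, toR b, toR c}

/-- `E` is an edge of `P`: a maximal (nondegenerate) line segment contained in the
topological boundary of `P`. -/
def IsEdge (P E : Set V) : Prop :=
  (∃ a b : V, a ≠ b ∧ E = segment ℝ a b) ∧ E ⊆ frontier P ∧
    ∀ F : Set V, (∃ a b : V, F = segment ℝ a b) → F ⊆ frontier P → E ⊆ F → F = E

/-- `v` is an edge vector of `P` (the difference of the endpoints of some edge of `P`). -/
def IsEdgeVector (P : Set V) (v : V) : Prop :=
  ∃ a b : V, a ≠ b ∧ IsEdge P (segment ℝ a b) ∧ v = b - a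

/-- Two plane vectors are parallel when their cross product vanishes. -/
def Par (v w : V) : Prop := v.1 * w.2 = v.2 * w.1

/-- `P` admits a lattice maximal Minkowski decomposition: `P` is a Minkowski sum of at
least two lattice polytopes, each of which is a lattice segment or a lattice triangle. -/
def HasLatticeMaximalDecomposition (P : Set V) : Prop :=
  ∃ (m : ℕ) (Ps : Fin (m + 1) → Set V), 1 ≤ m ∧
    P = ∑ k, Ps k ∧ ∀ k, IsLatticeSegment (Ps k) ∨ IsLatticeTriangle (Ps k)

/-- A convex polytope: the convex hull of a nonempty finite set of points. -/
def IsConvexPolytope (A : Set V) : Prop :=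
  ∃ S : Finset V, S.Nonempty ∧ A = convexHull ℝ (↑S : Set V)

/-- `A` is a homothet `λ • P + t` (`λ > 0`) of `P`. -/
def IsHomothet (A P : Set V) : Prop :=
  ∃ (l : ℝ) (t : V), 0 < l ∧ A = (fun x => l • x + t) '' P

/-- A (nondegenerate) line segment. -/
def IsSegmentSet (A : Set V) : Prop := ∃ a b : V, a ≠ b ∧ A = segment ℝ a b

/-- A triangle: the convex hull of three affinely independent points. -/
def IsTriangleSet (A : Set V) : Prop :=
  ∃ a b c : V, AffineIndependent ℝ ![a, b, c] ∧ A = convexHull ℝ {a, b, c}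

/-- A convex polytope is Minkowski-indecomposable if in every Minkowski decomposition
into two convex polytopes, one of the summands is a point or a homothet of the polytope. -/
def MinkowskiIndecomposable (Q : Set V) : Prop :=
  ∀ A B : Set V, IsConvexPolytope A → IsConvexPolytope B → Q = A + B →
    (∃ x, A = {x}) ∨ IsHomothet A Q ∨ (∃ x, B = {x}) ∨ IsHomothet B Q

/-- A parallelogram: a quadrilateral whose vertices `v₁ v₂ v₃ v₄` in cyclic order satisfy
`v₁ + v₃ = v₂ + v₄`. -/
def IsParallelogram (P : Set V) : Prop :=
  ∃ w : Fin 4 → V, Function.Injective w ∧ P.extremePoints ℝ = Set.range w ∧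
    w 0 + w 2 = w 1 + w 3

/-- The Gauntlett–Martelli–Sparks–Waldram toric diagram `𝒴^{p,q}`. -/
def GMSW (p q : ℤ) : Set V :=
  convexHull ℝ (toR '' ({(0, 0), (1, 0), (p, p), (p - q - 1, p - q)} : Set (ℤ × ℤ)))

/-- Cross product of lattice vectors. -/
def crossZ (u w : ℤ × ℤ) : ℤ := u.1 * w.2 - u.2 * w.1

/-- The `j`-th lattice segment summand `conv{(0,0),(1,j)}` of the Cho–Futaki–Ono diagram. -/
def cfoSeg (j : ℕ) : Set V := segment ℝ ((0 : ℝ), (0 : ℝ)) ((1 : ℝ), (j : ℝ))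

/-- The lattice triangle summand `conv{(0,0),(0,1),(1,s+1)}` of the Cho–Futaki–Ono diagram. -/
def cfoTri (s : ℕ) : Set V :=
  convexHull ℝ {((0 : ℝ), (0 : ℝ)), ((0 : ℝ), (1 : ℝ)), ((1 : ℝ), (s : ℝ) + 1)}

/-- The summands of the Cho–Futaki–Ono diagram: the segments `conv{(0,0),(1,j)}`,
`1 ≤ j ≤ r`, followed by the triangle `conv{(0,0),(0,1),(1,s+1)}`. -/
def cfoSummand (r s : ℕ) (k : Fin (r + 1)) : Set V :=
  if (k : ℕ) < r then cfoSeg ((k : ℕ) + 1) else cfoTri s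

/-- The Cho–Futaki–Ono toric diagram
`𝒫^{r,s} = conv{(0,0),(1,1)} + ⋯ + conv{(0,0),(1,r)} + conv{(0,0),(0,1),(1,s+1)}`. -/
def cfoP (r s : ℕ) : Set V := ∑ k, cfoSummand r s k

/-! ### Faces and Minkowski sums -/

/-- The standard pairing on the plane. -/
def dot (u p : V) : ℝ := u.1 * p.1 + u.2 * p.2

lemma dot_add (u p q : V) : dot u (p + q) = dot u p + dot u q := by
  simp only [dot, Prod.fst_add, Prod.snd_add]; ring

lemma dot_smul (u : V) (c : ℝ) (p : V) : dot u (c • p) = c * dot u p := by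
  simp only [dot, Prod.smul_fst, Prod.smul_snd, smul_eq_mul]; ring

/-- The pairing as a linear map. -/
def dotLin (u : V) : V →ₗ[ℝ] ℝ where
  toFun := dot u
  map_add' := dot_add u
  map_smul' := dot_smul u

lemma dot_sum {ι : Type*} [Fintype ι] (u : V) (p : ι → V) :
    dot u (∑ k, p k) = ∑ k, dot u (p k) :=
  map_sum (dotLin u) p Finset.univ

lemma exists_dot_eq (f : StrongDual ℝ V) : ∃ u : V, ∀ p, f p = dot u p := by
  refine ⟨(f (1, 0), f (0, 1)), fun p => ?_⟩
  have h : p = p.1 • ((1, 0) : V) + p.2 • ((0, 1) : V) := by ext <;> simp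
  rw [h, map_add, map_smul, map_smul]
  simp [dot]
  ring

/-- The face of `Q` on which the functional `dot u` is maximal. -/
def face (u : V) (Q : Set V) : Set V := {p ∈ Q | ∀ q ∈ Q, dot u q ≤ dot u p}

lemma sum_mem_face {ι : Type*} [Fintype ι] {Q : ι → Set V} {u : V} {p : ι → V}
    (hp : ∀ k, p k ∈ face u (Q k)) : ∑ k, p k ∈ face u (∑ k, Q k) := by
  refine ⟨(Set.mem_fintype_sum _ _).2 ⟨p, fun k => (hp k).1, rfl⟩, fun q hq => ?_⟩
  obtain ⟨g, hg, rfl⟩ := (Set.mem_fintype_sum _ _).1 hq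
  rw [dot_sum, dot_sum]
  exact Finset.sum_le_sum fun k _ => (hp k).2 _ (hg k)

lemma mem_face_of_sum_mem_face {ι : Type*} [Fintype ι] {Q : ι → Set V} {u : V}
    {p : ι → V} (hp : ∀ k, p k ∈ Q k) (h : ∑ k, p k ∈ face u (∑ k, Q k)) (k : ι) :
    p k ∈ face u (Q k) := by
  classical
  refine ⟨hp k, fun q hq => ?_⟩
  have h1 := h.2 (∑ j, Function.update p k q j) ((Set.mem_fintype_sum _ _).2
    ⟨_, fun j => by
      by_cases hj : j = k
      · subst hj; simpa using hq
      · simpa [Function.update_of_ne hj] using hp j, rfl⟩)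
  rw [Finset.sum_update_of_mem (Finset.mem_univ k), dot_add,
    ← Finset.add_sum_erase _ p (Finset.mem_univ k), dot_add, Finset.sdiff_singleton_eq_erase] at h1
  linarith

/-- The face of `Q` in direction `u` contains two points whose values under `dot w`
differ by `d`. -/
def HasFaceDiff (u w : V) (Q : Set V) (d : ℝ) : Prop :=
  ∃ p ∈ face u Q, ∃ q ∈ face u Q, dot w q - dot w p = d

lemma HasFaceDiff.zero {u : V} (w : V) {Q : Set V} (h : (face u Q).Nonempty) :
    HasFaceDiff u w Q 0 := by
  obtain ⟨p, hp⟩ := h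
  exact ⟨p, hp, p, hp, sub_self _⟩

lemma HasFaceDiff.sum {ι : Type*} [Fintype ι] {Q : ι → Set V} {u w : V} {d : ι → ℝ}
    (h : ∀ k, HasFaceDiff u w (Q k) (d k)) : HasFaceDiff u w (∑ k, Q k) (∑ k, d k) := by
  choose p hp q hq hd using h
  refine ⟨_, sum_mem_face hp, _, sum_mem_face hq, ?_⟩
  rw [dot_sum, dot_sum, ← Finset.sum_sub_distrib]
  exact Finset.sum_congr rfl fun k _ => hd k

lemma HasFaceDiff.exists_of_sum {ι : Type*} [Fintype ι] {Q : ι → Set V} {u w : V} {D : ℝ}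
    (h : HasFaceDiff u w (∑ k, Q k) D) :
    ∃ d : ι → ℝ, (∀ k, HasFaceDiff u w (Q k) (d k)) ∧ D = ∑ k, d k := by
  obtain ⟨p, hp, q, hq, rfl⟩ := h
  obtain ⟨p, hpm, rfl⟩ := (Set.mem_fintype_sum _ _).1 hp.1
  obtain ⟨q, hqm, rfl⟩ := (Set.mem_fintype_sum _ _).1 hq.1
  refine ⟨fun k => dot w (q k) - dot w (p k), fun k =>
    ⟨_, mem_face_of_sum_mem_face hpm hp k, _, mem_face_of_sum_mem_face hqm hq k, rfl⟩, ?_⟩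
  rw [dot_sum, dot_sum, Finset.sum_sub_distrib]

lemma HasFaceDiff.single_of_sum {ι : Type*} [Fintype ι] {Q : ι → Set V} {u w : V} {d : ℝ}
    (hne : ∀ k, (face u (Q k)).Nonempty) {i : ι} (h : HasFaceDiff u w (Q i) d) :
    HasFaceDiff u w (∑ k, Q k) d := by
  classical
  have := HasFaceDiff.sum (Q := Q) (u := u) (w := w) (d := fun k => if k = i then d else 0)
    (fun k => by
      by_cases hk : k = i
      · subst hk; simpa using h
      · simpa [hk] using HasFaceDiff.zero w (hne k))
  simpa using this

lemma HasFaceDiff.add_of_sum {ι : Type*} [Fintype ι] {Q : ι → Set V} {u w : V} {d e : ℝ}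
    (hne : ∀ k, (face u (Q k)).Nonempty) {i j : ι} (hij : i ≠ j)
    (hi : HasFaceDiff u w (Q i) d) (hj : HasFaceDiff u w (Q j) e) :
    HasFaceDiff u w (∑ k, Q k) (d + e) := by
  classical
  have := HasFaceDiff.sum (Q := Q) (u := u) (w := w)
    (d := fun k => (if k = i then d else 0) + if k = j then e else 0)
    (fun k => by
      by_cases hk : k = i
      · subst hk; simpa [hij] using hi
      · by_cases hk' : k = j
        · subst hk'; simpa [hk] using hj
        · simpa [hk, hk'] using HasFaceDiff.zero w (hne k))
  simpa [Finset.sum_add_distrib] using this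

lemma face_vadd (u t : V) (Q : Set V) : face u (t +ᵥ Q) = t +ᵥ face u Q := by
  ext p
  simp only [face, Set.mem_vadd_set_iff_neg_vadd_mem, vadd_eq_add, Set.mem_ofPred_eq, dot_add]
  refine and_congr_right fun _ => ⟨fun h q hq => ?_, fun h q hq => ?_⟩
  · have := h (t + q) (by simpa using hq)
    rw [dot_add] at this
    have h0 : dot u (-t) = - dot u t := by simp only [dot, Prod.fst_neg, Prod.snd_neg]; ring
    linarith
  · have := h _ hq
    rw [dot_add] at this
    linarith

lemma hasFaceDiff_vadd {u w t : V} {Q : Set V} {d : ℝ} :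
    HasFaceDiff u w (t +ᵥ Q) d ↔ HasFaceDiff u w Q d := by
  simp only [HasFaceDiff, face_vadd, Set.mem_vadd_set]
  constructor
  · rintro ⟨_, ⟨p, hp, rfl⟩, _, ⟨q, hq, rfl⟩, rfl⟩
    exact ⟨p, hp, q, hq, by simp only [vadd_eq_add, dot_add]; ring⟩
  · rintro ⟨p, hp, q, hq, rfl⟩
    exact ⟨_, ⟨p, hp, rfl⟩, _, ⟨q, hq, rfl⟩, by simp only [vadd_eq_add, dot_add]; ring⟩

lemma dot_continuous (u : V) : Continuous (dot u) := by
  unfold dot; fun_prop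

lemma face_nonempty {Q : Set V} (hQ : IsCompact Q) (hne : Q.Nonempty) (u : V) :
    (face u Q).Nonempty := by
  obtain ⟨p, hp, h⟩ := hQ.exists_isMaxOn hne (dot_continuous u).continuousOn
  exact ⟨p, hp, fun q hq => h hq⟩

lemma mem_face_convexHull {T : Set V} {u v : V} (hv : v ∈ T)
    (h : ∀ w ∈ T, dot u w ≤ dot u v) : v ∈ face u (convexHull ℝ T) :=
  ⟨subset_convexHull ℝ T hv, fun _ hq =>
    convexHull_min (t := {q | dot u q ≤ dot u v}) h
      (convex_halfSpace_le (dotLin u).isLinear _) hq⟩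

lemma mem_extremePoints_of_face_eq {P : Set V} {u v : V} (h : face u P = {v}) :
    v ∈ P.extremePoints ℝ := by
  have hv : v ∈ face u P := h ▸ rfl
  refine exposedPoints_subset_extremePoints ⟨hv.1,
    ⟨dotLin u, dot_continuous u⟩, fun y hy => ⟨hv.2 y hy, fun hle => ?_⟩⟩
  have : y ∈ face u P := ⟨hy, fun q hq => (hv.2 q hq).trans hle⟩
  rwa [h] at this

/-! ### Lattice polytopes -/

/-- The embedding of the lattice as an additive homomorphism. -/
def toRHom : ℤ × ℤ →+ V where
  toFun := toR
  map_zero' := by simp [toR]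
  map_add' p q := by simp [toR]

lemma IsLatticePolytope.add {A B : Set V} (hA : IsLatticePolytope A)
    (hB : IsLatticePolytope B) : IsLatticePolytope (A + B) := by
  classical
  obtain ⟨S, hS, rfl⟩ := hA
  obtain ⟨T, hT, rfl⟩ := hB
  refine ⟨S + T, hS.add hT, ?_⟩
  rw [← convexHull_add, Finset.coe_add]
  exact congrArg _ (Set.image_add toRHom).symm

lemma IsLatticePolytope.sum {ι : Type*} [Fintype ι] {Q : ι → Set V}
    (h : ∀ k, IsLatticePolytope (Q k)) : IsLatticePolytope (∑ k, Q k) :=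
  Finset.sum_induction Q IsLatticePolytope (fun _ _ => IsLatticePolytope.add)
    ⟨{0}, by simp, by simp [toR, ← Set.singleton_zero]; rfl⟩ fun k _ => h k

lemma IsLatticePolytope.isCompact {P : Set V} (h : IsLatticePolytope P) : IsCompact P := by
  obtain ⟨S, -, rfl⟩ := h
  exact (S.finite_toSet.image _).isCompact_convexHull ℝ

lemma IsLatticePolytope.convex {P : Set V} (h : IsLatticePolytope P) : Convex ℝ P := by
  obtain ⟨S, -, rfl⟩ := h
  exact convex_convexHull ℝ _

lemma IsLatticePolytope.nonempty {P : Set V} (h : IsLatticePolytope P) : P.Nonempty := by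
  obtain ⟨S, hS, rfl⟩ := h
  exact (hS.to_set.image toR).convexHull

lemma IsLatticePolytope.extremePoints_subset {P : Set V} (h : IsLatticePolytope P) :
    P.extremePoints ℝ ⊆ latticePoints := by
  obtain ⟨S, -, rfl⟩ := h
  exact extremePoints_convexHull_subset.trans (Set.image_subset_range _ _)

lemma isLatticePolytope_triple (a b c : ℤ × ℤ) :
    IsLatticePolytope (convexHull ℝ {toR a, toR b, toR c}) := by
  classical
  exact ⟨{a, b, c}, by simp, by simp [Set.image_insert_eq]⟩

lemma IsLatticeSegment.isLatticePolytope {Q : Set V} (h : IsLatticeSegment Q) :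
    IsLatticePolytope Q := by
  obtain ⟨a, b, -, rfl⟩ := h
  rw [← convexHull_pair]
  simpa using isLatticePolytope_triple a b b

lemma IsLatticeTriangle.isLatticePolytope {Q : Set V} (h : IsLatticeTriangle Q) :
    IsLatticePolytope Q := by
  obtain ⟨a, b, c, -, rfl⟩ := h
  exact isLatticePolytope_triple a b c

/-! ### Segments and triangles of unit width -/

/-- The set bounded by the lines `x = 0`, `x = 1`, `y = l x` and `y = h + (l - h) x`. It is a
segment for `h = 0` and a triangle for `h > 0`. -/
def wedge (h l : ℝ) : Set V :=
  {p | 0 ≤ p.1 ∧ p.1 ≤ 1 ∧ l * p.1 ≤ p.2 ∧ p.2 ≤ h + (l - h) * p.1}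

lemma wedge_zero (l : ℝ) : wedge 0 l = segment ℝ (0, 0) (1, l) := by
  ext ⟨x, y⟩
  rw [segment_eq_image]
  simp only [wedge, Set.mem_ofPred_eq, Set.mem_image, Set.mem_Icc, Prod.smul_mk, Prod.mk_add_mk,
    Prod.mk.injEq, smul_eq_mul]
  constructor
  · rintro ⟨h0, h1, h2, h3⟩
    exact ⟨x, ⟨h0, h1⟩, by ring, by linarith⟩
  · rintro ⟨t, ⟨h0, h1⟩, rfl, rfl⟩
    refine ⟨by linarith, by linarith, by linarith, by linarith⟩

lemma wedge_one (l : ℝ) : wedge 1 l = convexHull ℝ {(0, 0), (0, 1), (1, l)} := by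
  apply Set.Subset.antisymm
  · rintro ⟨x, y⟩ ⟨h0, h1, h2, h3⟩
    simp only at h0 h1 h2 h3
    have key := (convex_convexHull ℝ ({(0, 0), (0, 1), (1, l)} : Set V)).sum_mem
      (t := Finset.univ) (w := ![1 - x - (y - l * x), y - l * x, x])
      (z := ![(0, 0), (0, 1), (1, l)])
      (by intro i _; fin_cases i <;> simp <;> linarith)
      (by simp [Fin.sum_univ_three])
      (by intro i _; apply subset_convexHull; fin_cases i <;> simp)
    convert key using 1
    ext <;> simp [Fin.sum_univ_three]
    ring
  · apply convexHull_min
    · rintro p (rfl | rfl | rfl) <;> simp [wedge]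
    · have : wedge 1 l = {p | dot (-1, 0) p ≤ 0} ∩ {p | dot (1, 0) p ≤ 1} ∩
          {p | dot (l, -1) p ≤ 0} ∩ {p | dot (1 - l, 1) p ≤ 1} := by
        ext p
        simp only [wedge, dot, Set.mem_ofPred_eq, Set.mem_inter_iff]
        constructor
        · rintro ⟨h0, h1, h2, h3⟩
          refine ⟨⟨⟨?_, ?_⟩, ?_⟩, ?_⟩ <;> linarith
        · rintro ⟨⟨⟨h0, h1⟩, h2⟩, h3⟩
          refine ⟨?_, ?_, ?_, ?_⟩ <;> linarith
      rw [this]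
      have hc := fun u c => convex_halfSpace_le (dotLin u).isLinear c
      exact (((hc _ _).inter (hc _ _)).inter (hc _ _)).inter (hc _ _)

section wedge

variable {h l τ d : ℝ}

lemma mem_wedge_left (hh : 0 ≤ h) : ((0, 0) : V) ∈ wedge h l := by
  simp [wedge, hh]

lemma mem_wedge_top (hh : 0 ≤ h) : ((0, h) : V) ∈ wedge h l := by
  simp [wedge, hh]

lemma mem_wedge_right : ((1, l) : V) ∈ wedge h l := by
  simp [wedge]

lemma mem_face_upper (hh : 0 ≤ h) {p : V} (hp : p ∈ face (-τ, 1) (wedge h l)) :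
    0 ≤ p.1 ∧ p.1 ≤ 1 ∧ p.2 = h + (l - h) * p.1 ∧
      (l - h < τ → p.1 = 0) ∧ (τ < l - h → p.1 = 1) := by
  obtain ⟨⟨h0, h1, h2, h3⟩, hm⟩ := hp
  have hL := hm _ (mem_wedge_top hh)
  have hR := hm _ mem_wedge_right
  have hM := hm (p.1, h + (l - h) * p.1) ⟨h0, h1, by simp; nlinarith, le_rfl⟩
  simp only [dot] at hL hR hM
  refine ⟨h0, h1, by linarith, fun hlt => ?_, fun hlt => ?_⟩ <;> nlinarith

lemma mem_face_lower (hh : 0 ≤ h) {p : V} (hp : p ∈ face (τ, -1) (wedge h l)) :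
    0 ≤ p.1 ∧ p.1 ≤ 1 ∧ p.2 = l * p.1 ∧
      (τ < l → p.1 = 0) ∧ (l < τ → p.1 = 1) := by
  obtain ⟨⟨h0, h1, h2, h3⟩, hm⟩ := hp
  have hL := hm _ (mem_wedge_left hh)
  have hR := hm _ mem_wedge_right
  have hM := hm (p.1, l * p.1) ⟨h0, h1, le_rfl, by simp; nlinarith⟩
  simp only [dot] at hL hR hM
  refine ⟨h0, h1, by linarith, fun hlt => ?_, fun hlt => ?_⟩ <;> nlinarith

lemma face_upper_eq_right (hh : 0 ≤ h) (hτ : τ < l - h) :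
    face (-τ, 1) (wedge h l) = {(1, l)} := by
  ext p
  refine ⟨fun hp => ?_, ?_⟩
  · obtain ⟨-, -, h2, -, h3⟩ := mem_face_upper hh hp
    ext <;> simp [h2, h3 hτ]
  · rintro rfl
    refine ⟨mem_wedge_right, fun q hq => ?_⟩
    obtain ⟨h0, h1, h2, h3⟩ := hq
    simp only [dot]
    nlinarith

lemma face_upper_eq_left (hh : 0 ≤ h) (hτ : l - h < τ) :
    face (-τ, 1) (wedge h l) = {(0, h)} := by
  ext p
  refine ⟨fun hp => ?_, ?_⟩
  · obtain ⟨-, -, h2, h3, -⟩ := mem_face_upper hh hp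
    ext <;> simp [h2, h3 hτ]
  · rintro rfl
    refine ⟨mem_wedge_top hh, fun q hq => ?_⟩
    obtain ⟨h0, h1, h2, h3⟩ := hq
    simp only [dot]
    nlinarith

lemma face_lower_eq_right (hh : 0 ≤ h) (hτ : l < τ) :
    face (τ, -1) (wedge h l) = {(1, l)} := by
  ext p
  refine ⟨fun hp => ?_, ?_⟩
  · obtain ⟨-, -, h2, -, h3⟩ := mem_face_lower hh hp
    ext <;> simp [h2, h3 hτ]
  · rintro rfl
    refine ⟨mem_wedge_right, fun q hq => ?_⟩
    obtain ⟨h0, h1, h2, h3⟩ := hq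
    simp only [dot]
    nlinarith

lemma face_lower_eq_left (hh : 0 ≤ h) (hτ : τ < l) :
    face (τ, -1) (wedge h l) = {(0, 0)} := by
  ext p
  refine ⟨fun hp => ?_, ?_⟩
  · obtain ⟨-, -, h2, h3, -⟩ := mem_face_lower hh hp
    ext <;> simp [h2, h3 hτ]
  · rintro rfl
    refine ⟨mem_wedge_left hh, fun q hq => ?_⟩
    obtain ⟨h0, h1, h2, h3⟩ := hq
    simp only [dot]
    nlinarith

lemma HasFaceDiff.upper_le (hh : 0 ≤ h) (hd : HasFaceDiff (-τ, 1) (1, 0) (wedge h l) d) :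
    d ≤ if τ = l - h then 1 else 0 := by
  obtain ⟨p, hp, q, hq, rfl⟩ := hd
  obtain ⟨p0, p1, p2, p3, p4⟩ := mem_face_upper hh hp
  obtain ⟨q0, q1, q2, q3, q4⟩ := mem_face_upper hh hq
  simp only [dot]
  split_ifs with hτ
  · linarith
  · rcases lt_or_gt_of_ne hτ with hlt | hlt
    · linarith [p4 hlt, q4 hlt]
    · linarith [p3 hlt, q3 hlt]

lemma HasFaceDiff.lower_le (hh : 0 ≤ h) (hd : HasFaceDiff (τ, -1) (1, 0) (wedge h l) d) :
    d ≤ if τ = l then 1 else 0 := by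
  obtain ⟨p, hp, q, hq, rfl⟩ := hd
  obtain ⟨p0, p1, p2, p3, p4⟩ := mem_face_lower hh hp
  obtain ⟨q0, q1, q2, q3, q4⟩ := mem_face_lower hh hq
  simp only [dot]
  split_ifs with hτ
  · linarith
  · rcases lt_or_gt_of_ne hτ with hlt | hlt
    · linarith [p3 hlt, q3 hlt]
    · linarith [p4 hlt, q4 hlt]

lemma HasFaceDiff.left_le (hh : 0 ≤ h) (hd : HasFaceDiff (-1, 0) (0, 1) (wedge h l) d) :
    d ≤ h := by
  obtain ⟨p, ⟨⟨p0, p1, p2, p3⟩, hp⟩, q, ⟨⟨q0, q1, q2, q3⟩, hq⟩, rfl⟩ := hd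
  have hp := hp _ (mem_wedge_left hh)
  have hq := hq _ (mem_wedge_left hh)
  simp only [dot] at hp hq ⊢
  have hp0 : p.1 = 0 := by linarith
  have hq0 : q.1 = 0 := by linarith
  rw [hp0] at p2
  rw [hq0] at q3
  linarith

lemma HasFaceDiff.right_le (hd : HasFaceDiff (1, 0) (0, 1) (wedge h l) d) : d ≤ 0 := by
  obtain ⟨p, ⟨⟨p0, p1, p2, p3⟩, hp⟩, q, ⟨⟨q0, q1, q2, q3⟩, hq⟩, rfl⟩ := hd
  have hp := hp _ mem_wedge_right
  have hq := hq _ mem_wedge_right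
  simp only [dot] at hp hq ⊢
  have hp0 : p.1 = 1 := by linarith
  have hq0 : q.1 = 1 := by linarith
  rw [hp0] at p2
  rw [hq0] at q3
  linarith

lemma hasFaceDiff_upper (hh : 0 ≤ h) : HasFaceDiff (-(l - h), 1) (1, 0) (wedge h l) 1 := by
  refine ⟨(0, h), ⟨mem_wedge_top hh, ?_⟩, (1, l), ⟨mem_wedge_right, ?_⟩, by simp [dot]⟩ <;>
  · rintro q ⟨h0, h1, h2, h3⟩
    simp only [dot]
    linarith

lemma hasFaceDiff_left (hh : 0 ≤ h) : HasFaceDiff (-1, 0) (0, 1) (wedge h l) h := by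
  refine ⟨(0, 0), ⟨mem_wedge_left hh, ?_⟩, (0, h), ⟨mem_wedge_top hh, ?_⟩, by simp [dot]⟩ <;>
  · rintro q ⟨h0, h1, h2, h3⟩
    simp only [dot]
    linarith

end wedge

/-! ### The summands of the Cho–Futaki–Ono diagram -/

/-- The length of the vertical edge of the `k`-th summand. -/
def cfoHeight (r k : ℕ) : ℝ := if k < r then 0 else 1

/-- The slope of the lower edge of the `k`-th summand. -/
def cfoLower (r s k : ℕ) : ℝ := if k < r then (k : ℝ) + 1 else (s : ℝ) + 1

/-- The slope of the upper edge of the `k`-th summand. -/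
def cfoUpper (r s k : ℕ) : ℝ := cfoLower r s k - cfoHeight r k

lemma cfoHeight_nonneg (r k : ℕ) : 0 ≤ cfoHeight r k := by
  unfold cfoHeight; split_ifs <;> norm_num

lemma cfoSummand_eq (r s : ℕ) (k : Fin (r + 1)) :
    cfoSummand r s k = wedge (cfoHeight r k) (cfoLower r s k) := by
  unfold cfoSummand cfoHeight cfoLower
  split_ifs
  · rw [wedge_zero, cfoSeg]; push_cast; rfl
  · rw [wedge_one, cfoTri]

lemma isLatticePolytope_cfoSummand (r s : ℕ) (k : Fin (r + 1)) :
    IsLatticePolytope (cfoSummand r s k) := by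
  unfold cfoSummand
  split_ifs
  · refine IsLatticeSegment.isLatticePolytope ⟨(0, 0), (1, (k : ℤ) + 1), by simp, ?_⟩
    simp [cfoSeg, toR]
  · convert isLatticePolytope_triple (0, 0) (0, 1) (1, (s : ℤ) + 1) using 1
    simp [cfoTri, toR]

lemma cfoSummand_face_nonempty (r s : ℕ) (u : V) (k : Fin (r + 1)) :
    (face u (cfoSummand r s k)).Nonempty :=
  face_nonempty (isLatticePolytope_cfoSummand r s k).isCompact
    (isLatticePolytope_cfoSummand r s k).nonempty u

lemma isLatticePolytope_cfoP (r s : ℕ) : IsLatticePolytope (cfoP r s) :=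
  IsLatticePolytope.sum (isLatticePolytope_cfoSummand r s)

section slopes

variable {r s : ℕ}

lemma cfoLower_injective (hs : r + 1 ≤ s) :
    Function.Injective fun k : Fin (r + 1) => cfoLower r s k := by
  rintro ⟨i, hi⟩ ⟨j, hj⟩ h
  simp only [cfoLower] at h
  rw [Fin.mk.injEq]
  split_ifs at h <;> norm_cast at h <;> omega

lemma cfoUpper_injective (hs : r + 1 ≤ s) :
    Function.Injective fun k : Fin (r + 1) => cfoUpper r s k := by
  rintro ⟨i, hi⟩ ⟨j, hj⟩ h
  simp only [cfoUpper, cfoLower, cfoHeight] at h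
  rw [Fin.mk.injEq]
  split_ifs at h <;> simp only [sub_zero, add_sub_cancel_right] at h <;> norm_cast at h <;> omega

lemma cfoUpper_eq_cfoLower (hs : r + 1 ≤ s) {i j : Fin (r + 1)}
    (h : cfoUpper r s i = cfoLower r s j) : i = j ∧ (i : ℕ) < r := by
  obtain ⟨i, hi⟩ := i
  obtain ⟨j, hj⟩ := j
  simp only [cfoUpper, cfoLower, cfoHeight] at h
  rw [Fin.mk.injEq]
  split_ifs at h <;> simp only [sub_zero, add_sub_cancel_right] at h <;> norm_cast at h <;>
    simp only <;> omega

end slopes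

/-- A bound on a sum of indicator-bounded terms over pairwise distinct values. -/
lemma sum_le_one_of_injective {ι : Type*} [Fintype ι] {f : ι → ℝ} (hf : Function.Injective f)
    {τ : ℝ} {d : ι → ℝ} (hd : ∀ k, d k ≤ if τ = f k then 1 else 0) :
    ∑ k, d k ≤ 1 ∧ (0 < ∑ k, d k → ∃ k, τ = f k) := by
  classical
  have hle := Finset.sum_le_sum fun k (_ : k ∈ Finset.univ) => hd k
  by_cases h : ∃ k, τ = f k
  · obtain ⟨k, rfl⟩ := h
    refine ⟨hle.trans ?_, fun _ => ⟨k, rfl⟩⟩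
    simp [hf.eq_iff]
  · push Not at h
    simp only [h, if_false, Finset.sum_const_zero] at hle
    exact ⟨by linarith, fun h0 => absurd h0 (not_lt.2 hle)⟩

/-- The bounds on the edges of a set that a Minkowski summand of the diagram inherits. -/
structure EdgeBounds (r s : ℕ) (Q : Set V) : Prop where
  upper : ∀ τ d, HasFaceDiff (-τ, 1) (1, 0) Q d →
    d ≤ 1 ∧ (0 < d → ∃ i : Fin (r + 1), τ = cfoUpper r s i)
  lower : ∀ τ d, HasFaceDiff (τ, -1) (1, 0) Q d →
    d ≤ 1 ∧ (0 < d → ∃ i : Fin (r + 1), τ = cfoLower r s i)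
  left : ∀ d, HasFaceDiff (-1, 0) (0, 1) Q d → d ≤ 1
  right : ∀ d, HasFaceDiff (1, 0) (0, 1) Q d → d ≤ 0

lemma edgeBounds_cfoP {r s : ℕ} (hs : r + 1 ≤ s) : EdgeBounds r s (cfoP r s) where
  upper τ d h := by
    obtain ⟨d, hd, rfl⟩ := h.exists_of_sum
    refine sum_le_one_of_injective (cfoUpper_injective hs) fun k => ?_
    have := hd k
    rw [cfoSummand_eq] at this
    exact this.upper_le (cfoHeight_nonneg _ _)
  lower τ d h := by
    obtain ⟨d, hd, rfl⟩ := h.exists_of_sum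
    refine sum_le_one_of_injective (cfoLower_injective hs) fun k => ?_
    have := hd k
    rw [cfoSummand_eq] at this
    exact this.lower_le (cfoHeight_nonneg _ _)
  left d h := by
    obtain ⟨d, hd, rfl⟩ := h.exists_of_sum
    have : ∀ k : Fin (r + 1), d k ≤ cfoHeight r k := fun k => by
      have := hd k
      rw [cfoSummand_eq] at this
      exact this.left_le (cfoHeight_nonneg _ _)
    refine (Finset.sum_le_sum fun k _ => this k).trans ?_
    rw [Fin.sum_univ_castSucc]
    simp [cfoHeight]
  right d h := by
    obtain ⟨d, hd, rfl⟩ := h.exists_of_sum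
    refine Finset.sum_nonpos fun k _ => ?_
    have := hd k
    rw [cfoSummand_eq] at this
    exact this.right_le

lemma hasFaceDiff_cfoP (r s : ℕ) (i : Fin (r + 1)) :
    HasFaceDiff (-cfoUpper r s i, 1) (1, 0) (cfoP r s) 1 :=
  HasFaceDiff.single_of_sum (cfoSummand_face_nonempty r s _) (i := i) <| by
    rw [cfoSummand_eq]
    exact hasFaceDiff_upper (cfoHeight_nonneg _ _)

lemma EdgeBounds.of_sum {r s : ℕ} {ι : Type*} [Fintype ι] {Q : ι → Set V}
    (hne : ∀ u k, (face u (Q k)).Nonempty) (h : EdgeBounds r s (∑ k, Q k)) (i : ι) :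
    EdgeBounds r s (Q i) where
  upper τ d hd := h.upper τ d (hd.single_of_sum (hne _))
  lower τ d hd := h.lower τ d (hd.single_of_sum (hne _))
  left d hd := h.left d (hd.single_of_sum (hne _))
  right d hd := h.right d (hd.single_of_sum (hne _))

/-! ### Classification of the possible summands -/

section classification

variable {r s : ℕ} {a b c : ℤ × ℤ}

/-- The slope of the line through two lattice points. -/
def latticeSlope (a b : ℤ × ℤ) : ℝ := ((b.2 : ℝ) - a.2) / (b.1 - a.1)

lemma latticeSlope_mul (h : a.1 < b.1) :
    latticeSlope a b * ((b.1 : ℝ) - a.1) = b.2 - a.2 :=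
  div_mul_cancel₀ _ (sub_ne_zero.2 (by exact_mod_cast h.ne'))

lemma hasFaceDiff_triple_upper (h : a.1 < b.1)
    (hc : dot (-latticeSlope a b, 1) (toR c) ≤ dot (-latticeSlope a b, 1) (toR a)) :
    HasFaceDiff (-latticeSlope a b, 1) (1, 0) (convexHull ℝ {toR a, toR b, toR c})
      ((b.1 : ℝ) - a.1) := by
  have hm := latticeSlope_mul h
  have hab : dot (-latticeSlope a b, 1) (toR a) = dot (-latticeSlope a b, 1) (toR b) := by
    simp only [dot, toR]; linarith
  refine ⟨toR a, mem_face_convexHull (by simp) ?_, toR b, mem_face_convexHull (by simp) ?_,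
    by simp [dot, toR]⟩ <;>
  · rintro w (rfl | rfl | rfl) <;> linarith

lemma hasFaceDiff_triple_lower (h : a.1 < b.1)
    (hc : dot (latticeSlope a b, -1) (toR c) ≤ dot (latticeSlope a b, -1) (toR a)) :
    HasFaceDiff (latticeSlope a b, -1) (1, 0) (convexHull ℝ {toR a, toR b, toR c})
      ((b.1 : ℝ) - a.1) := by
  have hm := latticeSlope_mul h
  have hab : dot (latticeSlope a b, -1) (toR a) = dot (latticeSlope a b, -1) (toR b) := by
    simp only [dot, toR]; linarith
  refine ⟨toR a, mem_face_convexHull (by simp) ?_, toR b, mem_face_convexHull (by simp) ?_,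
    by simp [dot, toR]⟩ <;>
  · rintro w (rfl | rfl | rfl) <;> linarith

lemma EdgeBounds.width_le (hQ : EdgeBounds r s (convexHull ℝ {toR a, toR b, toR c})) :
    b.1 - a.1 ≤ 1 := by
  rcases le_or_gt b.1 a.1 with h | h
  · omega
  have : ((b.1 : ℝ) - a.1) ≤ 1 := by
    rcases le_total (dot (-latticeSlope a b, 1) (toR c)) (dot (-latticeSlope a b, 1) (toR a))
      with hc | hc
    · exact (hQ.upper _ _ (hasFaceDiff_triple_upper h hc)).1
    · refine (hQ.lower _ _ (hasFaceDiff_triple_lower h ?_)).1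
      simp only [dot] at hc ⊢
      linarith
  exact_mod_cast this

lemma vadd_convexHull_triple (t p q w : V) :
    t +ᵥ convexHull ℝ {p, q, w} = convexHull ℝ {t + p, t + q, t + w} := by
  rw [← convexHull_vadd]
  simp [Set.vadd_set_insert]

lemma EdgeBounds.segment (hs : r + 1 ≤ s) (h : a.1 < b.1)
    (hQ : EdgeBounds r s (segment ℝ (toR a) (toR b))) :
    ∃ i : Fin (r + 1), (i : ℕ) < r ∧ ∃ t : V, segment ℝ (toR a) (toR b) =
      t +ᵥ cfoSummand r s i := by
  have hQ' : EdgeBounds r s (convexHull ℝ {toR a, toR b, toR b}) := by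
    simpa [convexHull_pair] using hQ
  have hm := latticeSlope_mul h
  have h1 : b.1 = a.1 + 1 := by have := hQ'.width_le; omega
  have hpos : (0 : ℝ) < (b.1 : ℝ) - a.1 := sub_pos.2 (by exact_mod_cast h)
  obtain ⟨i, hi⟩ := (hQ'.upper _ _ (hasFaceDiff_triple_upper h
    (by simp only [dot, toR]; linarith))).2 hpos
  obtain ⟨j, hj⟩ := (hQ'.lower _ _ (hasFaceDiff_triple_lower h
    (by simp only [dot, toR]; linarith))).2 hpos
  obtain ⟨rfl, hir⟩ := cfoUpper_eq_cfoLower hs (hi.symm.trans hj)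
  refine ⟨i, hir, toR a, ?_⟩
  have hb : toR b = toR a + (1, cfoLower r s i) := by
    rw [hj] at hm
    ext
    · simp [toR, h1]
    · simp only [h1] at hm
      push_cast at hm
      simp only [toR, Prod.snd_add]
      linarith
  have h0 : ((0, 0) : V) = 0 := rfl
  rw [cfoSummand_eq, cfoHeight, if_pos hir, wedge_zero, hb, ← convexHull_pair, ← convexHull_pair,
    ← convexHull_vadd]
  simp [Set.vadd_set_insert, h0]

lemma EdgeBounds.triangle (hab : a.1 = b.1) (hlt : a.2 < b.2) (hc : c.1 ≠ a.1)
    (hQ : EdgeBounds r s (convexHull ℝ {toR a, toR b, toR c})) :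
    ∃ (t : V) (e : ℝ), convexHull ℝ {toR a, toR b, toR c} = t +ᵥ wedge 1 e := by
  have habR : (a.1 : ℝ) = b.1 := by exact_mod_cast hab
  have hltR : (a.2 : ℝ) < b.2 := by exact_mod_cast hlt
  have hd : dot (0, 1) (toR b) - dot (0, 1) (toR a) = (b.2 : ℝ) - a.2 := by simp [dot, toR]
  rcases lt_or_gt_of_ne hc with hlt' | hlt'
  · have hcR : (c.1 : ℝ) < a.1 := by exact_mod_cast hlt'
    have := hQ.right _ ⟨toR a, mem_face_convexHull (by simp) ?_, toR b,
      mem_face_convexHull (by simp) ?_, hd⟩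
    · linarith
    all_goals
      rintro w (rfl | rfl | rfl) <;> simp only [dot, toR] <;> linarith
  · have hcR : (a.1 : ℝ) < c.1 := by exact_mod_cast hlt'
    have h1 := hQ.left _ ⟨toR a, mem_face_convexHull (by simp) ?_, toR b,
      mem_face_convexHull (by simp) ?_, hd⟩
    · have hQ' : EdgeBounds r s (convexHull ℝ {toR a, toR c, toR b}) := by
        rwa [Set.pair_comm]
      have h2 : c.1 = a.1 + 1 := by have := hQ'.width_le; omega
      have h3 : b.2 = a.2 + 1 := by
        have : b.2 - a.2 ≤ 1 := by exact_mod_cast h1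
        omega
      refine ⟨toR a, (c.2 : ℝ) - a.2, ?_⟩
      have e0 : toR a + (0, 0) = toR a := add_zero _
      have e1 : toR a + (0, 1) = toR b := by ext <;> simp [toR, hab, h3]
      have e2 : toR a + (1, (c.2 : ℝ) - a.2) = toR c := by ext <;> simp [toR, h2]
      rw [wedge_one, vadd_convexHull_triple, e0, e1, e2]
    all_goals
      rintro w (rfl | rfl | rfl) <;> simp only [dot, toR] <;> linarith

lemma EdgeBounds.exists_wedge (hab : a.1 = b.1) (hne : a ≠ b) (hc : c.1 ≠ a.1)
    (hQ : EdgeBounds r s (convexHull ℝ {toR a, toR b, toR c})) :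
    ∃ (t : V) (e : ℝ), convexHull ℝ {toR a, toR b, toR c} = t +ᵥ wedge 1 e := by
  rcases lt_trichotomy a.2 b.2 with h | h | h
  · exact hQ.triangle hab h hc
  · exact absurd (Prod.ext hab h) hne
  · rw [Set.insert_comm] at hQ ⊢
    exact hQ.triangle hab.symm h (hab ▸ hc)

lemma IsLatticeTriangle.exists_wedge {Q : Set V} (hT : IsLatticeTriangle Q)
    (hQ : EdgeBounds r s Q) : ∃ (t : V) (e : ℝ), Q = t +ᵥ wedge 1 e := by
  obtain ⟨a, b, c, hind, rfl⟩ := hT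
  have hne : ∀ {i j : Fin 3}, i ≠ j → ![toR a, toR b, toR c] i ≠ ![toR a, toR b, toR c] j :=
    fun h => hind.injective.ne h
  have h01 : a ≠ b := fun h => hne (i := 0) (j := 1) (by decide) (by simp [h])
  have h02 : a ≠ c := fun h => hne (i := 0) (j := 2) (by decide) (by simp [h])
  have h12 : b ≠ c := fun h => hne (i := 1) (j := 2) (by decide) (by simp [h])
  have hvert : ¬ (b.1 = a.1 ∧ c.1 = a.1) := by
    rintro ⟨hb, hc⟩
    rw [affineIndependent_iff_not_collinear_set, collinear_iff_of_mem (p₀ := toR a) (by simp)]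
      at hind
    refine hind ⟨(0, 1), ?_⟩
    rintro p (rfl | rfl | rfl)
    · exact ⟨0, by simp⟩
    · exact ⟨(b.2 : ℝ) - a.2, by ext <;> simp [toR, hb]⟩
    · exact ⟨(c.2 : ℝ) - a.2, by ext <;> simp [toR, hc]⟩
  have p1 : ({toR a, toR b, toR c} : Set V) = {toR b, toR a, toR c} := Set.insert_comm _ _ _
  have p2 : ({toR a, toR b, toR c} : Set V) = {toR a, toR c, toR b} := by
    rw [Set.pair_comm (toR b)]
  have p3 : ({toR a, toR b, toR c} : Set V) = {toR b, toR c, toR a} := by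
    rw [p1, Set.pair_comm (toR a)]
  have p4 : ({toR a, toR b, toR c} : Set V) = {toR c, toR a, toR b} := by
    rw [p2, Set.insert_comm]
  have p5 : ({toR a, toR b, toR c} : Set V) = {toR c, toR b, toR a} := by
    rw [p4, Set.pair_comm (toR a)]
  have w0 := hQ.width_le
  have w1 := (p1 ▸ hQ).width_le
  have w2 := (p2 ▸ hQ).width_le
  have w3 := (p3 ▸ hQ).width_le
  have w4 := (p4 ▸ hQ).width_le
  have w5 := (p5 ▸ hQ).width_le
  by_cases hab : a.1 = b.1
  · exact hQ.exists_wedge hab h01 (by omega)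
  by_cases hac : a.1 = c.1
  · rw [p2] at hQ ⊢
    exact hQ.exists_wedge hac h02 (by omega)
  · rw [p3] at hQ ⊢
    exact hQ.exists_wedge (by omega) h12 (by omega)

lemma IsLatticeSegment.exists_summand {Q : Set V} (hs : r + 1 ≤ s) (hS : IsLatticeSegment Q)
    (hQ : EdgeBounds r s Q) :
    ∃ i : Fin (r + 1), (i : ℕ) < r ∧ ∃ t : V, Q = t +ᵥ cfoSummand r s i := by
  obtain ⟨a, b, hne, rfl⟩ := hS
  have vertical : ∀ {a b : ℤ × ℤ}, a.1 = b.1 → a.2 < b.2 →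
      ¬ EdgeBounds r s (_root_.segment ℝ (toR a) (toR b)) := by
    intro a b h1 h2 hQ
    have h1R : (a.1 : ℝ) = b.1 := by exact_mod_cast h1
    have h2R : (a.2 : ℝ) < b.2 := by exact_mod_cast h2
    rw [← convexHull_pair] at hQ
    have := hQ.right ((b.2 : ℝ) - a.2) ⟨toR a, mem_face_convexHull (by simp) ?_, toR b,
      mem_face_convexHull (by simp) ?_, by simp [dot, toR]⟩
    · linarith
    all_goals
      rintro w (rfl | rfl) <;> simp only [dot, toR] <;> linarith
  rcases lt_trichotomy a.1 b.1 with h | h | h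
  · exact hQ.segment hs h
  · rcases lt_trichotomy a.2 b.2 with h' | h' | h'
    · exact absurd hQ (vertical h h')
    · exact absurd (Prod.ext h h') hne
    · rw [segment_symm] at hQ
      exact absurd hQ (vertical h.symm h')
  · rw [segment_symm] at hQ ⊢
    exact hQ.segment hs h

end classification

/-! ### Uniqueness of the decomposition -/

lemma HasFaceDiff.eq_cfoUpper {r s : ℕ} {i : Fin (r + 1)} {τ d : ℝ} (hd : 0 < d)
    (h : HasFaceDiff (-τ, 1) (1, 0) (cfoSummand r s i) d) : τ = cfoUpper r s i := by
  rw [cfoSummand_eq] at h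
  have := h.upper_le (cfoHeight_nonneg _ _)
  by_contra hne
  rw [if_neg (by simpa [cfoUpper] using hne)] at this
  linarith

/-- The summands of a lattice maximal decomposition are translates of those of the
Cho–Futaki–Ono decomposition. -/
lemma exists_summand_of_decomposition {r s : ℕ} (hs : r + 1 ≤ s) {ι : Type*} [Fintype ι]
    {Q : ι → Set V} (hP : cfoP r s = ∑ k, Q k)
    (hQ : ∀ k, IsLatticeSegment (Q k) ∨ IsLatticeTriangle (Q k))
    (hne : ∀ u k, (face u (Q k)).Nonempty) (k : ι) :
    ∃ (i : Fin (r + 1)) (t : V), Q k = t +ᵥ cfoSummand r s i := by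
  have hE : ∀ k, EdgeBounds r s (Q k) :=
    fun k => EdgeBounds.of_sum hne (hP ▸ edgeBounds_cfoP hs) k
  have hlast : cfoHeight r (Fin.last r) = 1 := by simp [cfoHeight]
  rcases hQ k with hk | hk
  · obtain ⟨i, -, t, ht⟩ := hk.exists_summand hs (hE k)
    exact ⟨i, t, ht⟩
  obtain ⟨d, hd, hsum⟩ := (hP ▸ hasFaceDiff_cfoP r s (Fin.last r)).exists_of_sum
  obtain ⟨j, -, hj⟩ : ∃ j ∈ Finset.univ, 0 < d j :=
    Finset.exists_lt_of_sum_lt (f := fun _ => (0 : ℝ)) (by simp [← hsum])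
  have hjd := hd j
  rcases hQ j with hj' | hj'
  · obtain ⟨i, hir, t, ht⟩ := hj'.exists_summand hs (hE j)
    rw [ht, hasFaceDiff_vadd] at hjd
    have := cfoUpper_injective hs (hjd.eq_cfoUpper hj)
    subst this
    simp at hir
  obtain ⟨t, e, ht⟩ := hk.exists_wedge (hE k)
  obtain ⟨t', e', ht'⟩ := hj'.exists_wedge (hE j)
  have hkj : k = j := by
    by_contra hkj
    have := (edgeBounds_cfoP hs).left (1 + 1) (by
      rw [hP]
      refine HasFaceDiff.add_of_sum (hne _) hkj ?_ ?_
      · rw [ht, hasFaceDiff_vadd]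
        exact hasFaceDiff_left zero_le_one
      · rw [ht', hasFaceDiff_vadd]
        exact hasFaceDiff_left zero_le_one)
    norm_num at this
  subst hkj
  refine ⟨Fin.last r, t, ?_⟩
  rw [ht, hasFaceDiff_vadd] at hjd
  have hle := hjd.upper_le zero_le_one
  have he : cfoUpper r s (Fin.last r) = e - 1 := by
    by_contra hne
    rw [if_neg hne] at hle
    linarith
  rw [ht, cfoSummand_eq, hlast]
  rw [cfoUpper, hlast] at he
  rw [show cfoLower r s (Fin.last r) = e by linarith]

lemma unique_decomposition {r s : ℕ} (hs : r + 1 ≤ s) {ι : Type*} [Fintype ι]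
    {Q : ι → Set V} (hP : cfoP r s = ∑ k, Q k)
    (hQ : ∀ k, IsLatticeSegment (Q k) ∨ IsLatticeTriangle (Q k)) :
    ∃ σ : ι ≃ Fin (r + 1), ∀ k, ∃ t : V, Q k = t +ᵥ cfoSummand r s (σ k) := by
  have hpoly : ∀ k, IsLatticePolytope (Q k) := fun k =>
    (hQ k).elim IsLatticeSegment.isLatticePolytope IsLatticeTriangle.isLatticePolytope
  have hne : ∀ u k, (face u (Q k)).Nonempty := fun u k =>
    face_nonempty (hpoly k).isCompact (hpoly k).nonempty u
  choose σ t ht using exists_summand_of_decomposition hs hP hQ hne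
  refine ⟨Equiv.ofBijective σ ⟨fun k j hkj => ?_, fun i => ?_⟩, fun k => ⟨t k, ht k⟩⟩
  · by_contra hne'
    have key : ∀ l, HasFaceDiff (-cfoUpper r s (σ l), 1) (1, 0) (Q l) 1 := fun l => by
      rw [ht, hasFaceDiff_vadd, cfoSummand_eq]
      exact hasFaceDiff_upper (cfoHeight_nonneg _ _)
    have h2 := hP ▸ HasFaceDiff.add_of_sum (hne _) hne' (key k) (hkj ▸ key j)
    have := ((edgeBounds_cfoP hs).upper _ _ h2).1
    norm_num at this
  · obtain ⟨d, hd, hsum⟩ := (hP ▸ hasFaceDiff_cfoP r s i).exists_of_sum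
    obtain ⟨j, -, hj⟩ : ∃ j ∈ Finset.univ, 0 < d j :=
      Finset.exists_lt_of_sum_lt (f := fun _ => (0 : ℝ)) (by simp [← hsum])
    have hjd := hd j
    rw [ht, hasFaceDiff_vadd] at hjd
    exact ⟨j, (cfoUpper_injective hs (hjd.eq_cfoUpper hj)).symm⟩

/-! ### The vertices of the diagram -/

/-- The contribution of the `k`-th summand to the `i`-th vertex of the lower boundary. -/
def lowerChoice (r s i k : ℕ) : V := if k < i then (1, cfoLower r s k) else (0, 0)

/-- The contribution of the `k`-th summand to the `i`-th vertex of the upper boundary. -/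
def upperChoice (r s i k : ℕ) : V :=
  if r + 1 ≤ k + i then (1, cfoLower r s k) else (0, cfoHeight r k)

/-- The vertex of the lower boundary with first coordinate `i`. -/
def lowerVertex (r s i : ℕ) : V := ∑ k : Fin (r + 1), lowerChoice r s i k

/-- The vertex of the upper boundary with first coordinate `i`. -/
def upperVertex (r s i : ℕ) : V := ∑ k : Fin (r + 1), upperChoice r s i k

section vertices

variable {r s i : ℕ}

lemma face_sum_eq_singleton {ι : Type*} [Fintype ι] {Q : ι → Set V} {u : V} {p : ι → V}
    (h : ∀ k, face u (Q k) = {p k}) : face u (∑ k, Q k) = {∑ k, p k} := by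
  apply Set.Subset.antisymm
  · intro q hq
    obtain ⟨g, hg, rfl⟩ := (Set.mem_fintype_sum _ _).1 hq.1
    refine Finset.sum_congr rfl fun k _ => ?_
    have := mem_face_of_sum_mem_face hg hq k
    rwa [h] at this
  · rintro _ rfl
    exact sum_mem_face fun k => by rw [h]; rfl

lemma exists_face_lowerChoice (hs : r + 1 ≤ s) (i : ℕ) :
    ∃ τ : ℝ, ∀ k : Fin (r + 1),
      face (τ, -1) (cfoSummand r s k) = {lowerChoice r s i k} := by
  have hs' : (r : ℝ) + 1 ≤ s := by exact_mod_cast hs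
  refine ⟨if i ≤ r then i + 1 / 2 else s + 2, fun ⟨k, hk⟩ => ?_⟩
  rw [cfoSummand_eq, lowerChoice]
  have hkr : (k : ℝ) ≤ r := by exact_mod_cast Nat.lt_succ_iff.1 hk
  simp only
  split_ifs with hi hki hki
  · refine face_lower_eq_right (cfoHeight_nonneg _ _) ?_
    have : (k : ℝ) + 1 ≤ i := by exact_mod_cast hki
    rw [cfoLower, if_pos (by omega)]
    linarith
  · refine face_lower_eq_left (cfoHeight_nonneg _ _) ?_
    have h1 : (i : ℝ) ≤ k := by exact_mod_cast not_lt.1 hki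
    rw [cfoLower]
    split_ifs <;> linarith
  · refine face_lower_eq_right (cfoHeight_nonneg _ _) ?_
    rw [cfoLower]
    split_ifs <;> linarith
  · omega

lemma exists_face_upperChoice (hs : r + 1 ≤ s) (i : ℕ) :
    ∃ τ : ℝ, ∀ k : Fin (r + 1),
      face (-τ, 1) (cfoSummand r s k) = {upperChoice r s i k} := by
  have hs' : (r : ℝ) + 1 ≤ s := by exact_mod_cast hs
  refine ⟨if 1 ≤ i then r + 3 / 2 - i else s + 1, fun ⟨k, hk⟩ => ?_⟩
  rw [cfoSummand_eq, upperChoice]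
  have hkr : (k : ℝ) ≤ r := by exact_mod_cast Nat.lt_succ_iff.1 hk
  simp only
  split_ifs with hi hki hki
  · refine face_upper_eq_right (cfoHeight_nonneg _ _) ?_
    have h1 : (r : ℝ) + 1 ≤ k + i := by exact_mod_cast hki
    have h2 : (1 : ℝ) ≤ i := by exact_mod_cast hi
    rw [cfoLower, cfoHeight]
    split_ifs <;> linarith
  · refine face_upper_eq_left (cfoHeight_nonneg _ _) ?_
    have h1 : (k : ℝ) + i ≤ r := by exact_mod_cast (by omega : k + i ≤ r)
    rw [cfoLower, cfoHeight, if_pos (by omega), if_pos (by omega)]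
    linarith
  · omega
  · refine face_upper_eq_left (cfoHeight_nonneg _ _) ?_
    rw [cfoLower, cfoHeight]
    split_ifs <;> linarith

lemma lowerVertex_mem_extremePoints (hs : r + 1 ≤ s) (i : ℕ) :
    lowerVertex r s i ∈ (cfoP r s).extremePoints ℝ := by
  obtain ⟨τ, hτ⟩ := exists_face_lowerChoice hs i
  exact mem_extremePoints_of_face_eq (face_sum_eq_singleton hτ)

lemma upperVertex_mem_extremePoints (hs : r + 1 ≤ s) (i : ℕ) :
    upperVertex r s i ∈ (cfoP r s).extremePoints ℝ := by
  obtain ⟨τ, hτ⟩ := exists_face_upperChoice hs i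
  exact mem_extremePoints_of_face_eq (face_sum_eq_singleton hτ)

lemma lowerVertex_fst (hi : i ≤ r + 1) : (lowerVertex r s i).1 = i := by
  have h : ∀ k : Fin (r + 1), (lowerChoice r s i k).1 = if (k : ℕ) < i then 1 else 0 :=
    fun k => by unfold lowerChoice; split_ifs <;> rfl
  rw [lowerVertex, Prod.fst_sum, Finset.sum_congr rfl fun k _ => h k,
    Fin.sum_univ_eq_sum_range (fun k => if k < i then (1 : ℝ) else 0), Finset.sum_boole]
  congr 1
  rw [show (Finset.range (r + 1)).filter (· < i) = Finset.range i by ext; simp; omega,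
    Finset.card_range]

lemma upperVertex_fst (hi : i ≤ r + 1) : (upperVertex r s i).1 = i := by
  have h : ∀ k : Fin (r + 1), (upperChoice r s i k).1 = if r + 1 ≤ k + i then 1 else 0 :=
    fun k => by unfold upperChoice; split_ifs <;> rfl
  rw [upperVertex, Prod.fst_sum, Finset.sum_congr rfl fun k _ => h k,
    Fin.sum_univ_eq_sum_range (fun k => if r + 1 ≤ k + i then (1 : ℝ) else 0), Finset.sum_boole]
  congr 1
  rw [show (Finset.range (r + 1)).filter (r + 1 ≤ · + i) = Finset.Ico (r + 1 - i) (r + 1) by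
    ext; simp; omega, Nat.card_Ico]
  omega

lemma lowerVertex_last : lowerVertex r s (r + 1) = upperVertex r s (r + 1) := by
  refine Finset.sum_congr rfl fun k _ => ?_
  rw [lowerChoice, upperChoice, if_pos (by omega), if_pos (by omega)]

lemma lowerVertex_zero : lowerVertex r s 0 = (0, 0) := by
  simp [lowerVertex, lowerChoice]

lemma upperVertex_zero : upperVertex r s 0 = (0, 1) := by
  have h : ∀ k : Fin (r + 1), upperChoice r s 0 k = (0, cfoHeight r k) := fun k => by
    rw [upperChoice, if_neg (by omega)]
  rw [upperVertex, Finset.sum_congr rfl fun k _ => h k]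
  ext
  · simp [Prod.fst_sum]
  · simp [Fin.sum_univ_castSucc, cfoHeight]

lemma lowerVertex_ne_upperVertex (hs : r + 1 ≤ s) {j : ℕ} (hi : i ≤ r) :
    lowerVertex r s i ≠ upperVertex r s j := by
  intro h
  obtain ⟨τ, hτ⟩ := exists_face_lowerChoice hs i
  obtain ⟨τ', hτ'⟩ := exists_face_upperChoice hs j
  have hmem : ∑ k : Fin (r + 1), lowerChoice r s i k ∈ face (-τ', 1) (cfoP r s) := by
    rw [cfoP, face_sum_eq_singleton hτ']
    exact h
  have hl : ∀ k : Fin (r + 1), lowerChoice r s i k ∈ cfoSummand r s k := fun k =>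
    ((hτ k).symm ▸ rfl : lowerChoice r s i k ∈ face (τ, -1) (cfoSummand r s k)).1
  have := mem_face_of_sum_mem_face hl hmem (Fin.last r)
  rw [hτ', lowerChoice, if_neg (by simpa using hi), upperChoice] at this
  split_ifs at this <;> simp [cfoHeight] at this

lemma snd_le_upperVertex (hs : r + 1 ≤ s) (hi : i ≤ r + 1) {p : V} (hp : p ∈ cfoP r s)
    (hpi : p.1 = i) : p.2 ≤ (upperVertex r s i).2 := by
  obtain ⟨τ, hτ⟩ := exists_face_upperChoice hs i
  have hm : upperVertex r s i ∈ face (-τ, 1) (cfoP r s) := by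
    rw [cfoP, face_sum_eq_singleton hτ]; rfl
  have := hm.2 p hp
  simp only [dot, upperVertex_fst hi, hpi] at this
  linarith

lemma lowerVertex_le_snd (hs : r + 1 ≤ s) (hi : i ≤ r + 1) {p : V} (hp : p ∈ cfoP r s)
    (hpi : p.1 = i) : (lowerVertex r s i).2 ≤ p.2 := by
  obtain ⟨τ, hτ⟩ := exists_face_lowerChoice hs i
  have hm : lowerVertex r s i ∈ face (τ, -1) (cfoP r s) := by
    rw [cfoP, face_sum_eq_singleton hτ]; rfl
  have := hm.2 p hp
  simp only [dot, lowerVertex_fst hi, hpi] at this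
  linarith

lemma fst_mem_Icc {p : V} (hp : p ∈ cfoP r s) : 0 ≤ p.1 ∧ p.1 ≤ r + 1 := by
  obtain ⟨g, hg, rfl⟩ := (Set.mem_fintype_sum _ _).1 hp
  have hb : ∀ k, 0 ≤ (g k).1 ∧ (g k).1 ≤ 1 := fun k => by
    have := hg k
    rw [cfoSummand_eq] at this
    exact ⟨this.1, this.2.1⟩
  rw [Prod.fst_sum]
  refine ⟨Finset.sum_nonneg fun k _ => (hb k).1,
    (Finset.sum_le_sum fun k _ => (hb k).2).trans ?_⟩
  simp

/-- The vertices of the Cho–Futaki–Ono diagram. -/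
def cfoVertices (r s : ℕ) : Set V :=
  lowerVertex r s '' ↑(Finset.range (r + 1)) ∪ upperVertex r s '' ↑(Finset.range (r + 2))

lemma ncard_cfoVertices (hs : r + 1 ≤ s) : (cfoVertices r s).ncard = 2 * r + 3 := by
  rw [cfoVertices, Set.ncard_union_eq _ ((Finset.finite_toSet _).image _)
    ((Finset.finite_toSet _).image _), Set.InjOn.ncard_image, Set.InjOn.ncard_image,
    Set.ncard_coe_finset, Set.ncard_coe_finset, Finset.card_range, Finset.card_range]
  · omega
  · intro i hi j hj h
    have := congrArg Prod.fst h
    simp only [Finset.coe_range, Set.mem_Iio] at hi hj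
    rw [upperVertex_fst (by omega), upperVertex_fst (by omega)] at this
    exact_mod_cast this
  · intro i hi j hj h
    have := congrArg Prod.fst h
    simp only [Finset.coe_range, Set.mem_Iio] at hi hj
    rw [lowerVertex_fst (by omega), lowerVertex_fst (by omega)] at this
    exact_mod_cast this
  · rw [Set.disjoint_left]
    rintro _ ⟨i, hi, rfl⟩ ⟨j, -, h⟩
    simp only [Finset.coe_range, Set.mem_Iio] at hi
    exact lowerVertex_ne_upperVertex hs (by omega) h.symm

lemma cfoVertices_subset (hs : r + 1 ≤ s) : cfoVertices r s ⊆ (cfoP r s).extremePoints ℝ := by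
  rintro _ (⟨i, -, rfl⟩ | ⟨i, -, rfl⟩)
  · exact lowerVertex_mem_extremePoints hs i
  · exact upperVertex_mem_extremePoints hs i

lemma lattice_point_cases (hs : r + 1 ≤ s) {p : V} (hp : p ∈ cfoP r s)
    (hl : p ∈ latticePoints) :
    p ∈ cfoVertices r s ∨ ∃ i : ℕ, 0 < i ∧ i ≤ r ∧ p.1 = i ∧
      (lowerVertex r s i).2 < p.2 ∧ p.2 < (upperVertex r s i).2 := by
  obtain ⟨⟨x, y⟩, rfl⟩ := hl
  obtain ⟨h0, h1⟩ := fst_mem_Icc hp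
  simp only [toR] at h0 h1
  have h0' : 0 ≤ x := by exact_mod_cast h0
  obtain ⟨i, rfl⟩ := Int.eq_ofNat_of_zero_le h0'
  have hi : i ≤ r + 1 := by exact_mod_cast h1
  have hpi : (toR ((i : ℤ), y)).1 = i := by simp [toR]
  have hlow := lowerVertex_le_snd hs hi hp hpi
  have hup := snd_le_upperVertex hs hi hp hpi
  have upper_mem : upperVertex r s i ∈ cfoVertices r s :=
    Or.inr ⟨i, by simp; omega, rfl⟩
  rcases hup.eq_or_lt with he | hlt
  · left
    rwa [show toR ((i : ℤ), y) = upperVertex r s i from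
      Prod.ext (hpi.trans (upperVertex_fst hi).symm) he]
  rcases hlow.eq_or_lt with he | hlt'
  · left
    have hpe : toR ((i : ℤ), y) = lowerVertex r s i :=
      Prod.ext (hpi.trans (lowerVertex_fst hi).symm) he.symm
    rw [hpe]
    rcases hi.lt_or_eq with hir | rfl
    · exact Or.inl ⟨i, by simpa using hir, rfl⟩
    · rwa [lowerVertex_last]
  refine Or.inr ⟨i, ?_, ?_, hpi, hlt', hlt⟩
  · rcases Nat.eq_zero_or_pos i with rfl | h
    · rw [upperVertex_zero] at hlt
      rw [lowerVertex_zero] at hlt'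
      simp only [toR] at hlt hlt'
      norm_cast at hlt hlt'
      omega
    · exact h
  · by_contra hir
    obtain rfl : i = r + 1 := by omega
    rw [lowerVertex_last] at hlt'
    exact lt_asymm hlt hlt'

lemma extremePoints_cfoP (hs : r + 1 ≤ s) :
    (cfoP r s).extremePoints ℝ = cfoVertices r s := by
  refine Set.Subset.antisymm (fun p hp => ?_) (cfoVertices_subset hs)
  have hl := (isLatticePolytope_cfoP r s).extremePoints_subset hp
  rcases lattice_point_cases hs hp.1 hl with h | ⟨i, -, hi, hpi, h1, h2⟩
  · exact h
  exfalso
  have hL := lowerVertex_fst (s := s) (by omega : i ≤ r + 1)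
  have hU := upperVertex_fst (s := s) (by omega : i ≤ r + 1)
  have hmem : p ∈ openSegment ℝ (lowerVertex r s i) (upperVertex r s i) := by
    have hd : 0 < (upperVertex r s i).2 - (lowerVertex r s i).2 := by linarith
    refine ⟨((upperVertex r s i).2 - p.2) / ((upperVertex r s i).2 - (lowerVertex r s i).2),
      (p.2 - (lowerVertex r s i).2) / ((upperVertex r s i).2 - (lowerVertex r s i).2),
      div_pos (by linarith) hd, div_pos (by linarith) hd, ?_, ?_⟩
    · field_simp
      ring
    · ext
      · simp only [Prod.fst_add, Prod.smul_fst, smul_eq_mul, hL, hU, hpi]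
        field_simp
        ring
      · simp only [Prod.snd_add, Prod.smul_snd, smul_eq_mul]
        field_simp
        ring
  have := hp.2 (lowerVertex_mem_extremePoints hs i).1 (upperVertex_mem_extremePoints hs i).1 hmem
  rw [← this] at h1
  exact lt_irrefl _ h1

lemma interior_cfoP_nonempty (r s : ℕ) : (interior (cfoP r s)).Nonempty := by
  obtain ⟨c, hc⟩ : (∑ k : Fin r, cfoSummand r s k.castSucc).Nonempty :=
    (IsLatticePolytope.sum fun k => isLatticePolytope_cfoSummand r s _).nonempty
  let U : Set V := {p | 0 < p.1} ∩ {p | p.1 < 1} ∩ {p | ((s : ℝ) + 1) * p.1 < p.2} ∩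
    {p | p.2 < 1 + (s : ℝ) * p.1}
  have hU : IsOpen U :=
    (((isOpen_lt (by fun_prop) (by fun_prop)).inter (isOpen_lt (by fun_prop) (by fun_prop))).inter
      (isOpen_lt (by fun_prop) (by fun_prop))).inter (isOpen_lt (by fun_prop) (by fun_prop))
  have hsub : c +ᵥ U ⊆ cfoP r s := by
    rintro _ ⟨p, ⟨⟨⟨h0, h1⟩, h2⟩, h3⟩, rfl⟩
    rw [cfoP, Fin.sum_univ_castSucc]
    refine Set.add_mem_add hc ?_
    simp only [Set.mem_ofPred_eq] at h0 h1 h2 h3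
    rw [cfoSummand_eq]
    simp only [wedge, cfoLower, cfoHeight, Fin.val_last, lt_irrefl, if_false, Set.mem_ofPred_eq]
    refine ⟨h0.le, h1.le, h2.le, by linarith⟩
  refine ⟨c + (1 / 2, (s : ℝ) / 2 + 3 / 4), interior_maximal hsub (hU.vadd c)
    ⟨_, ⟨⟨⟨?_, ?_⟩, ?_⟩, ?_⟩, rfl⟩⟩ <;> simp only [Set.mem_ofPred_eq] <;> linarith

/-- Boundary points of a convex set with nonempty interior have a supporting functional. -/
lemma exists_support {P : Set V} (hP : Convex ℝ P) (hint : (interior P).Nonempty) {p : V}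
    (hp : p ∉ interior P) : ∃ u : V, u ≠ 0 ∧ ∀ q ∈ P, dot u q ≤ dot u p := by
  obtain ⟨f, hf⟩ := geometric_hahn_banach_open_point hP.interior isOpen_interior hp
  obtain ⟨u, hu⟩ := exists_dot_eq f
  simp only [hu] at hf
  refine ⟨u, ?_, fun q hq => ?_⟩
  · rintro rfl
    obtain ⟨q, hq⟩ := hint
    simpa [dot] using hf q hq
  · have hq' : q ∈ closure (interior P) := by
      rw [hP.closure_interior_eq_closure_of_nonempty_interior hint]
      exact subset_closure hq
    exact closure_minimal (fun a ha => (hf a ha).le)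
      (isClosed_le (dot_continuous u) continuous_const) hq'

lemma isToricDiagram_cfoP (hs : r + 1 ≤ s) : IsToricDiagram (cfoP r s) := by
  have hpoly := isLatticePolytope_cfoP r s
  refine ⟨hpoly, interior_cfoP_nonempty r s, fun p hp hl => ?_⟩
  have hmem : p ∈ cfoP r s := hpoly.isCompact.isClosed.frontier_subset hp
  rcases lattice_point_cases hs hmem hl with h | ⟨i, hi0, hi, hpi, h1, h2⟩
  · exact cfoVertices_subset hs h
  exfalso
  obtain ⟨u, hu0, hu⟩ := exists_support hpoly.convex (interior_cfoP_nonempty r s) hp.2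
  have hA := hu _ (lowerVertex_mem_extremePoints hs i).1
  have hB := hu _ (upperVertex_mem_extremePoints hs i).1
  have hC := hu _ (lowerVertex_mem_extremePoints hs 0).1
  have hD := hu _ (upperVertex_mem_extremePoints hs (r + 1)).1
  have hi0' : (0 : ℝ) < i := by exact_mod_cast hi0
  have hi' : (i : ℝ) < r + 1 := by exact_mod_cast Nat.lt_succ_of_le hi
  simp only [dot, lowerVertex_fst (by omega : i ≤ r + 1), upperVertex_fst (by omega : i ≤ r + 1),
    lowerVertex_fst (Nat.zero_le (r + 1)), upperVertex_fst le_rfl, hpi] at hA hB hC hD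
  push_cast at hC hD
  have hu2 : u.2 = 0 := by
    rcases lt_trichotomy u.2 0 with h | h | h
    · nlinarith
    · exact h
    · nlinarith
  rw [hu2] at hC hD
  have hu1 : u.1 = 0 := by
    rcases lt_trichotomy u.1 0 with h | h | h
    · nlinarith
    · exact h
    · nlinarith
  exact hu0 (Prod.ext hu1 hu2)

end vertices

/-- For integers `r ≥ 1` and `s ≥ r + 1`, the diagram `𝒫^{r,s}` is a toric
diagram with exactly `2r + 3` extreme points, and, up to translating and reordering the
summands, the displayed decomposition is its unique lattice maximal Minkowski
decomposition. -/
theorem statement7 (r s : ℕ) (hr : 1 ≤ r) (hs : r + 1 ≤ s) :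
    IsToricDiagram (cfoP r s) ∧
    ((cfoP r s).extremePoints ℝ).ncard = 2 * r + 3 ∧
    ∀ (m : ℕ) (Ps : Fin (m + 1) → Set V), 1 ≤ m →
      cfoP r s = ∑ k, Ps k →
      (∀ k, IsLatticeSegment (Ps k) ∨ IsLatticeTriangle (Ps k)) →
      ∃ σ : Fin (m + 1) ≃ Fin (r + 1), ∀ k, ∃ t : V,
        Ps k = t +ᵥ cfoSummand r s (σ k) := by
  exact ⟨isToricDiagram_cfoP hs, by rw [extremePoints_cfoP hs, ncard_cfoVertices hs],
    fun _ _ _ hP hQ => unique_decomposition hs hP hQ⟩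
end
end

section
/- Let s ≥ 2 be an integer. Define the open region Ω_s := {(a,b) ∈ ℝ² : b − a + 3 > 0, b − (1+s)a + 3 > 0, a − b + 3(s−1) > 0, sa − b + 3(s−1) > 0, a + 3 > 0} and the function f_s(a,b) := (−a² + 2ab − b² + 3(s³−s²+2)a − 6b + 9(s³−1)) / ((a−b−3)·((s+1)a−b−3)·(a+3)·(a−b+3(s−1))·(sa−b+3(s−1))) for (a,b) ∈ Ω_s. If (a₀, b₀) ∈ Ω_s is a point at which f_s attains its minimum value over Ω_s, then a₀ is irrational. -/
open Set Pointwise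

noncomputable section

/-- The coefficients, as polynomials in `m = s - 1`, of the polynomial of degree eight satisfied by
the first critical coordinate `q = a / 3 + 1`. -/
def critCoeff {R : Type*} [CommRing R] (m : R) : ℕ → R
  | 0 => -8 * m ^ 2 - 32 * m - 32
  | 1 => -16 * m ^ 3 + 12 * m ^ 2 + 272 * m + 368
  | 2 => 208 * m ^ 3 + 690 * m ^ 2 - 168 * m - 1464
  | 3 => 128 * m ^ 4 - 192 * m ^ 3 - 3011 * m ^ 2 - 3232 * m + 2424
  | 4 => -768 * m ^ 4 - 3120 * m ^ 3 + 498 * m ^ 2 + 7680 * m - 1728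
  | 5 => -256 * m ^ 5 - 448 * m ^ 4 + 4200 * m ^ 3 + 6956 * m ^ 2 - 6000 * m + 432
  | 6 => m * (256 * m ^ 4 + 1952 * m ^ 3 + 872 * m ^ 2 - 6756 * m + 1512)
  | 7 => m ^ 2 * (-816 * m ^ 2 - 2472 * m + 1731)
  | 8 => 648 * m ^ 3
  | _ => 0

/-- The binary octic form with coefficients `critCoeff m`. -/
def critForm {R : Type*} [CommRing R] (m q d : R) : R :=
  critCoeff m 0 * d ^ 8 + critCoeff m 1 * q * d ^ 7 + critCoeff m 2 * q ^ 2 * d ^ 6 +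
    critCoeff m 3 * q ^ 3 * d ^ 5 + critCoeff m 4 * q ^ 4 * d ^ 4 + critCoeff m 5 * q ^ 5 * d ^ 3 +
    critCoeff m 6 * q ^ 6 * d ^ 2 + critCoeff m 7 * q ^ 7 * d + critCoeff m 8 * q ^ 8

lemma critForm_mul {R : Type*} [CommRing R] (m q d c : R) :
    critForm m (c * q) (c * d) = c ^ 8 * critForm m q d := by
  simp only [critForm]; ring

/-- Two cubics with a common root have vanishing Bézout determinant. -/
lemma bezout_eq_zero_of_common_root {R : Type*} [CommRing R] (f₀ f₁ f₂ f₃ g₀ g₁ g₂ g₃ x : R)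
    (hf : f₃ * x ^ 3 + f₂ * x ^ 2 + f₁ * x + f₀ = 0)
    (hg : g₃ * x ^ 3 + g₂ * x ^ 2 + g₁ * x + g₀ = 0)
    (b₃₂ b₃₁ b₃₀ b₂₁ b₂₀ b₁₀ : R)
    (h₃₂ : b₃₂ = f₃ * g₂ - g₃ * f₂) (h₃₁ : b₃₁ = f₃ * g₁ - g₃ * f₁)
    (h₃₀ : b₃₀ = f₃ * g₀ - g₃ * f₀) (h₂₁ : b₂₁ = f₂ * g₁ - g₂ * f₁)
    (h₂₀ : b₂₀ = f₂ * g₀ - g₂ * f₀) (h₁₀ : b₁₀ = f₁ * g₀ - g₁ * f₀) :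
    b₃₂ * ((b₃₀ + b₂₁) * b₁₀ - b₂₀ * b₂₀) - b₃₁ * (b₃₁ * b₁₀ - b₂₀ * b₃₀) +
      b₃₀ * (b₃₁ * b₂₀ - (b₃₀ + b₂₁) * b₃₀) = 0 := by
  have r₀ : b₃₂ * x ^ 2 + b₃₁ * x + b₃₀ = 0 := by
    rw [h₃₂, h₃₁, h₃₀]; linear_combination f₃ * hg - g₃ * hf
  have r₁ : b₃₁ * x ^ 2 + (b₃₀ + b₂₁) * x + b₂₀ = 0 := by
    rw [h₃₁, h₃₀, h₂₁, h₂₀]; linear_combination (f₃ * x + f₂) * hg - (g₃ * x + g₂) * hf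
  have r₂ : b₃₀ * x ^ 2 + b₂₀ * x + b₁₀ = 0 := by
    rw [h₃₀, h₂₀, h₁₀]
    linear_combination (f₃ * x ^ 2 + f₂ * x + f₁) * hg - (g₃ * x ^ 2 + g₂ * x + g₁) * hf
  linear_combination (b₃₁ * b₂₀ - (b₃₀ + b₂₁) * b₃₀) * r₀ - (b₃₂ * b₂₀ - b₃₁ * b₃₀) * r₁ +
    (b₃₂ * (b₃₀ + b₂₁) - b₃₁ * b₃₁) * r₂

set_option maxHeartbeats 4000000 in
lemma critForm_eq_zero_of_common_root (m q x : ℝ) (hm : 0 < m) (hq : 0 < q) (hqm : q < m + 2)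
    (hqm' : 2 * q ≠ m + 2)
    (h₁ : m * x * (1 - x + m) * q * (1 + x - q) -
      ((1 - x) * (1 + x) + m * q) * (1 - x + m * (q - x)) * (2 * q - (1 + x)) = 0)
    (h₃ : m * (1 - x + m) * q * ((1 - 2 * x) * (1 + x - q) + x * (1 - x)) -
      (2 * q - (1 + x)) * (1 - x) * ((1 - x + m) * (1 - x + m * q) + m * x * (1 + x - q)) = 0) :
    critForm m q 1 = 0 := by
  have hf : (3 * q * m + m + 2) * x ^ 3 +
      (-(3 * q ^ 2 * m + 4 * q * m ^ 2 + 8 * q * m + 4 * q + m + 2)) * x ^ 2 +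
      (6 * q ^ 2 * m ^ 2 + 10 * q ^ 2 * m + 3 * q * m + 8 * q - m - 2) * x +
      (-(2 * q ^ 3 * m ^ 2 + 2 * q ^ 2 * m ^ 2 + 7 * q ^ 2 * m - 2 * q * m ^ 2 - 2 * q * m + 4 * q
        - m - 2)) = 0 := by
    linear_combination h₁ + h₃
  have hg : (- 9 * q ^ 2 * m ^ 2 - 3 * q ^ 2 * m + 4 * q * m ^ 3 + 11 * q * m ^ 2 + 2 * q * m + 2 *
    m ^ 2 + 5 * m + 2) * x ^ 3 + (9 * q ^ 3 * m ^ 2 - 6 * q ^ 2 * m ^ 3 - 19 * q ^ 2 * m ^ 2 + 2 * q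
    ^ 2 * m - 8 * q * m ^ 2 - 19 * q * m - 4 * q - m - 2) * x ^ 2 + (8 * q ^ 3 * m ^ 3 + 5 * q ^ 3 *
    m ^ 2 + 4 * q ^ 2 * m ^ 3 + 26 * q ^ 2 * m ^ 2 + 15 * q ^ 2 * m - 2 * q * m ^ 3 - 3 * q * m ^ 2
    + 12 * q * m + 8 * q - 2 * m ^ 2 - 5 * m - 2) * x + (- 6 * q ^ 4 * m ^ 3 + q ^ 3 * m ^ 3 - 16 *
    q ^ 3 * m ^ 2 + q ^ 2 * m ^ 3 + 4 * q ^ 2 * m ^ 2 - 14 * q ^ 2 * m + 2 * q * m ^ 2 + 5 * q * m -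
    4 * q + m + 2) = 0 := by
    linear_combination (3 * q * m + m + 2) * h₁ - (m + 1) * x * hf
  have key := bezout_eq_zero_of_common_root _ _ _ _ _ _ _ _ x hf hg _ _ _ _ _ _ rfl rfl rfl rfl
    rfl rfl
  have fac : q ^ 3 * m ^ 5 * (q - m - 2) ^ 2 * (3 * q * m + m + 2) ^ 2 * (2 * q - m - 2) *
      critForm m q 1 = 0 := by
    rw [← key]
    simp only [critForm, critCoeff]
    ring
  have hne : q ^ 3 * m ^ 5 * (q - m - 2) ^ 2 * (3 * q * m + m + 2) ^ 2 * (2 * q - m - 2) ≠ 0 := by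
    have h1 : q - m - 2 ≠ 0 := by linarith
    have h2 : 2 * q - m - 2 ≠ 0 := fun h => hqm' (by linarith)
    have h3 : 3 * q * m + m + 2 ≠ 0 := by positivity
    positivity
  exact (mul_eq_zero.mp fac).resolve_left hne

set_option maxHeartbeats 4000000 in
lemma critForm_neg (m q : ℝ) (hm : 2 ≤ m) (hq : 1 / 2 ≤ q) (hq' : q ≤ 1 - 3 / (16 * m)) :
    critForm m q 1 < 0 := by
  obtain ⟨t, ht, rfl⟩ : ∃ t, 0 ≤ t ∧ m = t + 2 := ⟨m - 2, by linarith, by ring⟩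
  have hα : 0 ≤ 2 * q - 1 := by linarith
  have hβ : 0 ≤ 16 * (t + 2) - 3 - 16 * (t + 2) * q := by
    have := mul_le_mul_of_nonneg_left hq' (by positivity : 0 ≤ 16 * (t + 2))
    field_simp at this ⊢
    linarith
  obtain ⟨α, hα, hα'⟩ : ∃ α, 0 ≤ α ∧ α = 2 * q - 1 := ⟨_, hα, rfl⟩
  obtain ⟨β, hβ, hβ'⟩ : ∃ β, 0 ≤ β ∧ β = 16 * (t + 2) - 3 - 16 * (t + 2) * q := ⟨_, hβ, rfl⟩
  have hd : 8 * t + 13 = 8 * (t + 2) * α + β := by rw [hα', hβ']; ring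
  have hn : (8 * t + 13) * q = (8 * t + 29 / 2) * α + β / 2 := by rw [hα', hβ']; ring
  have hpos : 0 < 8 * (t + 2) * α + β := by rw [← hd]; positivity
  have h := critForm_mul (t + 2) q 1 (8 * t + 13)
  rw [hn, mul_one, hd] at h
  have : critForm (t + 2) ((8 * t + 29 / 2) * α + β / 2) (8 * (t + 2) * α + β) < 0 := by
    rcases hα.eq_or_lt with h0 | h0
    · subst h0
      have : 0 < β := by simpa using hpos
      rw [← neg_pos]
      simp only [critForm, critCoeff]
      ring_nf
      positivity
    · rw [← neg_pos]
      simp only [critForm, critCoeff]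
      ring_nf
      positivity
  rw [h] at this
  exact (pos_iff_neg_of_mul_neg this).mp (by positivity)

set_option maxHeartbeats 4000000 in
lemma critForm_pos (m q : ℝ) (hm : 2 ≤ m) (hq : 1 - 3 / (16 * m) + 1 / (8 * m ^ 2) ≤ q)
    (hq' : q ≤ 2) : 0 < critForm m q 1 := by
  obtain ⟨t, ht, rfl⟩ : ∃ t, 0 ≤ t ∧ m = t + 2 := ⟨m - 2, by linarith, by ring⟩
  have hα : 0 ≤ 16 * (t + 2) ^ 2 * q - (16 * (t + 2) ^ 2 - 3 * (t + 2) + 2) := by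
    have := mul_le_mul_of_nonneg_left hq (by positivity : 0 ≤ 16 * (t + 2) ^ 2)
    have e : 16 * (t + 2) ^ 2 * (1 - 3 / (16 * (t + 2)) + 1 / (8 * (t + 2) ^ 2)) =
      16 * (t + 2) ^ 2 - 3 * (t + 2) + 2 := by field_simp; ring
    linarith
  have hβ : 0 ≤ 2 - q := by linarith
  obtain ⟨α, hα, hα'⟩ : ∃ α, 0 ≤ α ∧
    α = 16 * (t + 2) ^ 2 * q - (16 * (t + 2) ^ 2 - 3 * (t + 2) + 2) := ⟨_, hα, rfl⟩
  obtain ⟨β, hβ, hβ'⟩ : ∃ β, 0 ≤ β ∧ β = 2 - q := ⟨_, hβ, rfl⟩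
  have hd : 16 * (t + 2) ^ 2 + 3 * t + 4 = α + 16 * (t + 2) ^ 2 * β := by rw [hα', hβ']; ring
  have hn : (16 * (t + 2) ^ 2 + 3 * t + 4) * q =
      2 * α + (16 * (t + 2) ^ 2 - 3 * (t + 2) + 2) * β := by rw [hα', hβ']; ring
  have hpos : 0 < α + 16 * (t + 2) ^ 2 * β := by rw [← hd]; positivity
  have h := critForm_mul (t + 2) q 1 (16 * (t + 2) ^ 2 + 3 * t + 4)
  rw [hn, mul_one, hd] at h
  have : 0 < critForm (t + 2) (2 * α + (16 * (t + 2) ^ 2 - 3 * (t + 2) + 2) * β)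
      (α + 16 * (t + 2) ^ 2 * β) := by
    rcases hα.eq_or_lt with h0 | h0
    · subst h0
      have : 0 < β := by
        refine hβ.lt_of_ne ?_
        rintro rfl
        simp at hpos
      simp only [critForm, critCoeff]
      ring_nf
      positivity
    · simp only [critForm, critCoeff]
      ring_nf
      positivity
  rw [h] at this
  exact (mul_pos_iff_of_pos_left (by positivity)).mp this

/-- The monic octic, integral over `ℤ[m]`, satisfied by `648 * m * q` when `critForm m q 1 = 0`. -/
def critMonic {R : Type*} [CommRing R] (m w : R) : R :=
  w ^ 8 + (-816 * m ^ 2 - 2472 * m + 1731) * w ^ 7 +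
    648 * (256 * m ^ 4 + 1952 * m ^ 3 + 872 * m ^ 2 - 6756 * m + 1512) * w ^ 6 +
    648 ^ 2 * critCoeff m 5 * w ^ 5 + 648 ^ 3 * m * critCoeff m 4 * w ^ 4 +
    648 ^ 4 * m ^ 2 * critCoeff m 3 * w ^ 3 + 648 ^ 5 * m ^ 3 * critCoeff m 2 * w ^ 2 +
    648 ^ 6 * m ^ 4 * critCoeff m 1 * w + 648 ^ 7 * m ^ 5 * critCoeff m 0

lemma critMonic_eq {R : Type*} [CommRing R] (m q : R) :
    critMonic m (648 * m * q) = 648 ^ 7 * m ^ 5 * critForm m q 1 := by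
  simp only [critMonic, critForm, critCoeff]; ring

lemma map_critMonic {R S : Type*} [CommRing R] [CommRing S] (φ : R →+* S) (m w : R) :
    φ (critMonic m w) = critMonic (φ m) (φ w) := by
  simp [critMonic, critCoeff, map_ofNat]

lemma exists_int_eq_of_critForm_eq_zero (m : ℤ) (q : ℚ) (h : critForm (m : ℚ) q 1 = 0) :
    ∃ w : ℤ, (w : ℚ) = 648 * m * q ∧ critMonic m w = 0 := by
  have hw : critMonic (m : ℚ) (648 * m * q) = 0 := by rw [critMonic_eq, h, mul_zero]
  have hint : IsIntegral ℤ (648 * m * q : ℚ) := by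
    refine ⟨critMonic (Polynomial.C m) Polynomial.X, ?_, ?_⟩
    · simp only [critMonic, critCoeff]
      monicity!
    · have := map_critMonic (Polynomial.eval₂RingHom (algebraMap ℤ ℚ) (648 * m * q))
        (Polynomial.C m) Polynomial.X
      simpa [hw] using this
  obtain ⟨w, hw'⟩ := IsIntegrallyClosed.isIntegral_iff.mp hint
  refine ⟨w, by simpa using hw', ?_⟩
  rw [← hw', ← eq_intCast (algebraMap ℤ ℚ) m, ← map_critMonic] at hw
  exact (map_eq_zero_iff (algebraMap ℤ ℚ) Int.cast_injective).mp hw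

lemma critMonic_one_ne_zero (w : ℤ) : critMonic 1 w ≠ 0 := by
  intro h
  have h7 : ∀ v : ZMod 7, critMonic 1 v ≠ 0 := by
    simp only [critMonic, critCoeff]; decide
  apply h7 w
  have := map_critMonic (Int.castRingHom (ZMod 7)) 1 w
  rw [h, map_zero, map_one] at this
  exact this.symm

lemma critMonic_ne_zero_of_lt : ∀ m < (162 : ℕ), ∀ i < (41 : ℕ), 2 ≤ m ∧ 1 ≤ i ∧ (2 * i - 1) * m <
  162 →
    critMonic (m : ℤ) (648 * m - 122 + i) ≠ 0 := by
  decide +kernel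

lemma critForm_ne_zero (m : ℤ) (hm : 1 ≤ m) (q : ℚ) (hq : 1 / 2 < q) (hq' : q < 2) :
    critForm (m : ℝ) (q : ℝ) 1 ≠ 0 := by
  intro h
  have hQ : critForm (m : ℚ) q 1 = 0 := by
    simp only [critForm, critCoeff] at h ⊢
    exact_mod_cast h
  obtain ⟨w, hwq, hw⟩ := exists_int_eq_of_critForm_eq_zero m q hQ
  rcases hm.eq_or_lt with rfl | hm
  · exact critMonic_one_ne_zero w hw
  have hm2 : (2 : ℝ) ≤ m := by exact_mod_cast hm
  have hwq : (w : ℝ) = 648 * m * q := by exact_mod_cast hwq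
  have hq : (1 / 2 : ℝ) < q := by simpa using (Rat.cast_lt (K := ℝ)).mpr hq
  have hq' : (q : ℝ) < 2 := by exact_mod_cast hq'
  have hlo : 1 - 3 / (16 * (m : ℝ)) < q := by
    by_contra! hc
    exact (critForm_neg m q hm2 hq.le hc).ne h
  have hhi : (q : ℝ) < 1 - 3 / (16 * (m : ℝ)) + 1 / (8 * (m : ℝ) ^ 2) := by
    by_contra! hc
    exact (critForm_pos m q hm2 hc hq'.le).ne' h
  have hlo' : (648 * m - 243 / 2 : ℝ) < w := by
    have := mul_lt_mul_of_pos_left hlo (by positivity : (0 : ℝ) < 648 * m)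
    have e : 648 * (m : ℝ) * (1 - 3 / (16 * (m : ℝ))) = 648 * m - 243 / 2 := by field_simp; ring
    rw [hwq]
    linarith
  have hhi' : ((2 * w - 1296 * m + 243) * m : ℝ) < 162 := by
    have := mul_lt_mul_of_pos_left hhi (by positivity : (0 : ℝ) < 1296 * m ^ 2)
    have e : 1296 * (m : ℝ) ^ 2 * (1 - 3 / (16 * (m : ℝ)) + 1 / (8 * (m : ℝ) ^ 2)) =
      1296 * m ^ 2 - 243 * m + 162 := by field_simp; ring
    rw [hwq]
    linarith
  have hlo : 1296 * m - 243 < 2 * w := by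
    have : (1296 * m - 243 : ℝ) < 2 * w := by linarith
    exact_mod_cast this
  have hhi : (2 * w - 1296 * m + 243) * m < 162 := by exact_mod_cast hhi'
  obtain ⟨i, hi⟩ := Int.eq_ofNat_of_zero_le (by omega : 0 ≤ w - (648 * m - 122))
  obtain ⟨n, rfl⟩ := Int.eq_ofNat_of_zero_le (by omega : 0 ≤ m)
  obtain rfl : w = 648 * n - 122 + (i : ℕ) := by linarith
  have hi1 : 1 ≤ i := by omega
  have hb : ((2 * i - 1 : ℕ) : ℤ) * n < 162 := by
    push_cast [show 1 ≤ 2 * i by omega]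
    linarith
  have hb : (2 * i - 1) * n < 162 := by exact_mod_cast hb
  have hn : 2 ≤ n := by omega
  refine critMonic_ne_zero_of_lt n ?_ i ?_ ⟨hn, hi1, hb⟩ hw
  · nlinarith [show 1 ≤ 2 * i - 1 by omega]
  · have : (2 * i - 1) * 2 < 162 := (Nat.mul_le_mul_left _ hn).trans_lt hb
    omega

/-- The derivative of a quotient vanishes at a local minimum, with denominators cleared. -/
lemma deriv_mul_eq_of_isLocalMin_div {n d : ℝ → ℝ} {n' d' t : ℝ} (hn : HasDerivAt n n' t)
    (hd : HasDerivAt d d' t) (h0 : d t ≠ 0) (hmin : IsLocalMin (fun y => n y / d y) t) :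
    n' * d t = n t * d' := by
  have h := hmin.hasDerivAt_eq_zero (hn.div hd h0)
  rw [div_eq_zero_iff] at h
  have := h.resolve_right (pow_ne_zero 2 h0)
  linarith

/-- The numerator of the volume function in the coordinates `x = (b - a + 3) / (3 * s)`,
`q = (a + 3) / 3`, with `m = s - 1`. -/
def volNum (m x q : ℝ) : ℝ := (1 - x) * (1 + x) + m * q

/-- The denominator of the volume function in the coordinates `x`, `q`. -/
def volDen (m x q : ℝ) : ℝ := x * (1 - x) * q * (1 + x - q) * (1 - x + m * (q - x))

/-- The slice of the Reeb cone in the coordinates `x`, `q`. -/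
def reebSlice (m : ℝ) : Set (ℝ × ℝ) :=
  {p | 0 < p.1 ∧ 0 < 1 - p.1 ∧ 0 < p.2 ∧ 0 < 1 + p.1 - p.2 ∧ 0 < 1 - p.1 + m * (p.2 - p.1)}

lemma isOpen_reebSlice (m : ℝ) : IsOpen (reebSlice m) := by
  simp only [reebSlice, Set.ofPred_and]
  refine IsOpen.inter ?_ (IsOpen.inter ?_ (IsOpen.inter ?_ (IsOpen.inter ?_ ?_))) <;>
    exact isOpen_lt (by fun_prop) (by fun_prop)

lemma critical_equations (m x q : ℝ) (hp : (x, q) ∈ reebSlice m)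
    (hmin : ∀ p ∈ reebSlice m, volNum m x q / volDen m x q ≤ volNum m p.1 p.2 / volDen m p.1 p.2) :
    m * q * (1 + x - q) * (1 - x + m * (q - x)) = volNum m x q *
        ((1 + x - q) * (1 - x + m * (q - x)) - q * (1 - x + m * (q - x)) + m * q * (1 + x - q)) ∧
      -2 * x * (x * (1 - x) * (1 + x - q) * (1 - x + m * (q - x))) = volNum m x q *
        (((1 - 2 * x) * (1 + x - q) + x * (1 - x)) * (1 - x + m * (q - x)) -
          (1 + m) * (x * (1 - x) * (1 + x - q))) := by
  have hU := (isOpen_reebSlice m).mem_nhds hp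
  obtain ⟨hx, hx', hq, hu, hk⟩ := hp
  dsimp only at hx hx' hq hu hk
  have hD : volDen m x q ≠ 0 := by unfold volDen; positivity
  constructor
  · have hloc : IsLocalMin (fun y => volNum m x y / volDen m x y) q := by
      have hc : Filter.Tendsto (fun y : ℝ => (x, y)) (nhds q) (nhds (x, q)) :=
        Continuous.tendsto (by fun_prop) q
      filter_upwards [hc hU] with y hy using hmin _ hy
    have hi := hasDerivAt_id' q
    have hn : HasDerivAt (fun y => volNum m x y) (m * 1) q :=
      (hi.const_mul m).const_add _
    have hd : HasDerivAt (fun y => volDen m x y) _ q :=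
      (((hi.const_mul (x * (1 - x))).mul (hi.const_sub (1 + x))).mul
        (((hi.sub_const x).const_mul m).const_add (1 - x)))
    have := deriv_mul_eq_of_isLocalMin_div hn hd hD hloc
    have hxx : x * (1 - x) ≠ 0 := by positivity
    apply mul_left_cancel₀ hxx
    simp only [volDen, Pi.mul_apply] at this
    linear_combination this
  · have hloc : IsLocalMin (fun y => volNum m y q / volDen m y q) x := by
      have hc : Filter.Tendsto (fun y : ℝ => (y, q)) (nhds x) (nhds (x, q)) :=
        Continuous.tendsto (by fun_prop) x
      filter_upwards [hc hU] with y hy using hmin _ hy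
    have hi := hasDerivAt_id' x
    have hn : HasDerivAt (fun y => volNum m y q) _ x :=
      ((hi.const_sub 1).mul (hi.const_add 1)).add_const _
    have hd : HasDerivAt (fun y => volDen m y q) _ x :=
      ((((hi.mul (hi.const_sub 1)).mul_const q).mul ((hi.const_add 1).sub_const q)).mul
        ((hi.const_sub 1).add ((hi.const_sub q).const_mul m)))
    have := deriv_mul_eq_of_isLocalMin_div hn hd hD hloc
    apply mul_left_cancel₀ hq.ne'
    simp only [volDen, Pi.mul_apply] at this
    linear_combination this

lemma critForm_eq_zero_of_isMin (m x q : ℝ) (hm : m = 1 ∨ 2 ≤ m) (hp : (x, q) ∈ reebSlice m)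
    (hmin : ∀ p ∈ reebSlice m, volNum m x q / volDen m x q ≤ volNum m p.1 p.2 / volDen m p.1 p.2) :
    1 / 2 < q ∧ q < 2 ∧ critForm m q 1 = 0 := by
  obtain ⟨e₁, e₂⟩ := critical_equations m x q hp hmin
  obtain ⟨hx, hx', hq, hu, hk⟩ := hp
  dsimp only at hx hx' hq hu hk
  have hm0 : 0 < m := by rcases hm with hm | hm <;> linarith
  have hN : 0 < volNum m x q := by unfold volNum; positivity
  have h₁ : m * x * (1 - x + m) * q * (1 + x - q) -
      volNum m x q * (1 - x + m * (q - x)) * (2 * q - (1 + x)) = 0 := by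
    unfold volNum at e₁ ⊢
    linear_combination -e₁
  have h₂ : x * (1 - x) * (1 + x - q) *
      ((1 - x + m) * (1 - x + m * q) + m * x * (1 + x - q)) -
      volNum m x q * (1 - x + m * (q - x)) * ((1 - 2 * x) * (1 + x - q) + x * (1 - x)) = 0 := by
    unfold volNum at e₂ ⊢
    linear_combination e₂
  have h₃ : m * (1 - x + m) * q * ((1 - 2 * x) * (1 + x - q) + x * (1 - x)) -
      (2 * q - (1 + x)) * (1 - x) *
        ((1 - x + m) * (1 - x + m * q) + m * x * (1 + x - q)) = 0 := by
    have hxu : x * (1 + x - q) ≠ 0 := by positivity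
    apply mul_left_cancel₀ hxu
    linear_combination ((1 - 2 * x) * (1 + x - q) + x * (1 - x)) * h₁ - (2 * q - (1 + x)) * h₂
  have hq2 : 0 < 2 * q - (1 + x) := by
    have : 0 < volNum m x q * (1 - x + m * (q - x)) * (2 * q - (1 + x)) := by
      rw [← sub_eq_zero.mp h₁]
      positivity
    exact (mul_pos_iff_of_pos_left (by positivity)).mp this
  refine ⟨by linarith, by linarith, critForm_eq_zero_of_common_root m q x hm0 hq
    (by linarith) ?_ h₁ h₃⟩
  intro hqm
  obtain rfl : m = 1 := hm.resolve_right fun hm => by linarith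
  obtain rfl : q = 3 / 2 := by linarith
  unfold volNum at h₁
  have : (x - 2) * (10 * x ^ 2 - 25 * x + 16) = 0 := by
    linear_combination (4 / 3) * (h₁ + h₃)
  rcases mul_eq_zero.mp this with h | h
  · linarith
  · nlinarith [sq_nonneg (4 * x - 5)]

/-- Irregularity of the `r = 1` Cho–Futaki–Ono cones: any minimizer
`(a₀, b₀)` over `Ω_s` of the normalized volume function `f_s` has irrational first
coordinate. -/
theorem statement10 (s : ℤ) (hs : 2 ≤ s)
    (Ω : Set (ℝ × ℝ))
    (hΩ : Ω = {x : ℝ × ℝ |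
      0 < x.2 - x.1 + 3 ∧ 0 < x.2 - (1 + (s : ℝ)) * x.1 + 3 ∧
      0 < x.1 - x.2 + 3 * ((s : ℝ) - 1) ∧ 0 < (s : ℝ) * x.1 - x.2 + 3 * ((s : ℝ) - 1) ∧
      0 < x.1 + 3})
    (f : ℝ → ℝ → ℝ)
    (hf : ∀ a b : ℝ, f a b =
      (-a ^ 2 + 2 * a * b - b ^ 2 + 3 * ((s : ℝ) ^ 3 - (s : ℝ) ^ 2 + 2) * a - 6 * b
          + 9 * ((s : ℝ) ^ 3 - 1)) /
        ((a - b - 3) * (((s : ℝ) + 1) * a - b - 3) * (a + 3) * (a - b + 3 * ((s : ℝ) - 1)) *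
          ((s : ℝ) * a - b + 3 * ((s : ℝ) - 1))))
    (a₀ b₀ : ℝ) (hmem : (a₀, b₀) ∈ Ω)
    (hmin : ∀ x ∈ Ω, f a₀ b₀ ≤ f x.1 x.2) :
    Irrational a₀ := by
  subst hΩ
  have hs' : (2 : ℝ) ≤ s := by exact_mod_cast hs
  set m : ℝ := s - 1 with hm
  have hsm : (s : ℝ) = m + 1 := by rw [hm]; ring
  have hm12 : m = 1 ∨ 2 ≤ m := by
    rcases hs.eq_or_lt with rfl | hs
    · left; rw [hm]; norm_num
    · right
      have : (3 : ℝ) ≤ s := by exact_mod_cast hs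
      linarith
  have hf' : ∀ x q : ℝ, f (3 * (q - 1)) (3 * (q - 1) - 3 + 3 * s * x) =
      volNum m x q / volDen m x q / (27 * s) := by
    intro x q
    rw [hf, div_div, hsm]
    have hs0 : (9 * (m + 1) ^ 2 : ℝ) ≠ 0 := by rw [← hsm]; positivity
    rw [← mul_div_mul_left (volNum m x q) _ hs0]
    unfold volNum volDen
    congr 1 <;> ring
  have hslice : ∀ x q : ℝ, (x, q) ∈ reebSlice m ↔
      (3 * (q - 1), 3 * (q - 1) - 3 + 3 * s * x) ∈ {x : ℝ × ℝ |
      0 < x.2 - x.1 + 3 ∧ 0 < x.2 - (1 + (s : ℝ)) * x.1 + 3 ∧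
      0 < x.1 - x.2 + 3 * ((s : ℝ) - 1) ∧ 0 < (s : ℝ) * x.1 - x.2 + 3 * ((s : ℝ) - 1) ∧
      0 < x.1 + 3} := by
    intro x q
    have h3s : (0 : ℝ) < 3 * s := by positivity
    simp only [reebSlice, Set.mem_ofPred_eq]
    rw [show 3 * (q - 1) - 3 + 3 * s * x - 3 * (q - 1) + 3 = 3 * s * x by ring,
      show 3 * (q - 1) - 3 + 3 * s * x - (1 + s) * (3 * (q - 1)) + 3 = 3 * s * (1 + x - q) by ring,
      show 3 * (q - 1) - (3 * (q - 1) - 3 + 3 * s * x) + 3 * (s - 1) = 3 * s * (1 - x) by ring,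
      show s * (3 * (q - 1)) - (3 * (q - 1) - 3 + 3 * s * x) + 3 * (s - 1) =
        3 * (1 - x + m * (q - x)) by rw [hsm]; ring,
      show 3 * (q - 1) + 3 = 3 * q by ring]
    simp only [mul_pos_iff_of_pos_left h3s, mul_pos_iff_of_pos_left (zero_lt_three' ℝ)]
    tauto
  obtain ⟨q, rfl⟩ : ∃ q, a₀ = 3 * (q - 1) := ⟨a₀ / 3 + 1, by ring⟩
  obtain ⟨x, rfl⟩ : ∃ x, b₀ = 3 * (q - 1) - 3 + 3 * s * x :=
    ⟨(b₀ - 3 * (q - 1) + 3) / (3 * s), by field_simp; ring⟩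
  obtain ⟨hq, hq', hcrit⟩ := critForm_eq_zero_of_isMin m x q hm12 ((hslice x q).mpr hmem) (by
    rintro ⟨x', q'⟩ hp
    have := hmin _ ((hslice x' q').mp hp)
    rw [hf', hf'] at this
    exact (div_le_div_iff_of_pos_right (by positivity)).mp this)
  rintro ⟨r, hr⟩
  have hqr : q = ((r / 3 + 1 : ℚ) : ℝ) := by push_cast; linarith
  rw [hqr] at hq hq' hcrit
  refine critForm_ne_zero (s - 1) (by omega) (r / 3 + 1) ?_ ?_ ?_
  · exact_mod_cast (by simpa using hq : ((1 / 2 : ℚ) : ℝ) < ((r / 3 + 1 : ℚ) : ℝ))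
  · exact_mod_cast hq'
  · simpa [hm] using hcrit
end
end
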